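/- Let φ : ℝ³ → ℝ be smooth, nonnegative, radial, radially nonincreasing, with φ(x) = 1 for |x| ≤ 1 and φ(x) = 0 for |x| ≥ 2. Then there is a constant C > 0 (depending only on φ) with the following interaction Morawetz estimate: for every smooth global solution u of the defocusing quintic nonlinear wave equation with E(u(t)) ≤ E for all t, every R₀ > 0, every J ≥ 1, and every a ∈ ℝ, setting 𝒯 = e^J R₀, one has ∫_{a}^{a+𝒯} (1/J) ∫_{R₀}^{e^J R₀} (1/R) ∫_{ℝ³} ∫_{ℝ³} [ (1/2)( |∂ₜu(t,x)| − |∇ₓu(t,x)| )² + (1/6) u(t,x)⁶ ] · φ((x−y)/R) · [ (1/2) ∂ₜu(t,y)² + (1/2) |∇ₓu(t,y)|² + (2/3) u(t,y)⁶ ] dx dy dR dt ≤ C 𝒯 E² / J. -/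

import Mathlib

open MeasureTheory Real Set Function
open scoped ENNReal NNReal FourierTransform

noncomputable section

/-- Three-dimensional Euclidean space `ℝ³`. -/
abbrev E3 : Type := EuclideanSpace ℝ (Fin 3)

/-- The time derivative `∂ₜ u` of a function `u : ℝ × ℝ³ → ℝ` (curried). -/
def tderiv (u : ℝ → E3 → ℝ) (t : ℝ) (x : E3) : ℝ := deriv (fun s => u s x) t

/-- The second time derivative `∂ₜ² u`. -/
def tderiv2 (u : ℝ → E3 → ℝ) (t : ℝ) (x : E3) : ℝ := deriv (fun s => tderiv u s x) t

/-- The spatial Laplacian `Δ f = ∑ᵢ ∂ᵢ² f` of `f : ℝ³ → ℝ`. -/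
def lap (f : E3 → ℝ) (x : E3) : ℝ :=
  ∑ i : Fin 3, iteratedFDeriv ℝ 2 f x ![EuclideanSpace.single i 1, EuclideanSpace.single i 1]

/-- `f : ℝ³ → ℝ` is a Schwartz function: it is smooth and all of its derivatives decay
faster than any polynomial. -/
def IsSchwartz (f : E3 → ℝ) : Prop :=
  ContDiff ℝ (⊤ : ℕ∞) f ∧ ∀ k n : ℕ, ∃ C : ℝ, ∀ x, ‖x‖ ^ k * ‖iteratedFDeriv ℝ n f x‖ ≤ C

/-- `u` is a smooth solution of the defocusing quintic nonlinear wave equation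
`∂ₜ²u − Δu + u⁵ = 0` on the time interval `I`, Schwartz in the space variable at each time. -/
def IsNLWOn (u : ℝ → E3 → ℝ) (I : Set ℝ) : Prop :=
  ContDiffOn ℝ (⊤ : ℕ∞) (uncurry u) (I ×ˢ univ) ∧
  (∀ t ∈ I, IsSchwartz (u t) ∧ IsSchwartz (tderiv u t)) ∧
  (∀ t ∈ I, ∀ x, tderiv2 u t x - lap (u t) x + (u t x) ^ 5 = 0)

/-- `u` is a smooth global solution of the defocusing quintic nonlinear wave equation. -/
def IsNLW (u : ℝ → E3 → ℝ) : Prop := IsNLWOn u univ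

/-- The energy `E(u(t)) = ∫ (1/2)|∂ₜu|² + (1/2)|∇ₓu|² + (1/6)u⁶ dx`. -/
def energy (u : ℝ → E3 → ℝ) (t : ℝ) : ℝ :=
  ∫ x : E3, ((1/2) * (tderiv u t x) ^ 2 + (1/2) * ‖gradient (u t) x‖ ^ 2 + (1/6) * (u t x) ^ 6)

/-- The spatial `L^q` norm (`q` finite), valued in `ℝ≥0∞`. -/
def xNorm {F : Type*} [NormedAddCommGroup F] (q : ℝ) (f : E3 → F) : ℝ≥0∞ :=
  (∫⁻ x : E3, (‖f x‖₊ : ℝ≥0∞) ^ q) ^ (1/q)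

/-- The mixed norm `‖u‖_{L^p_t L^q_x (I × ℝ³)}` for finite `p, q`. -/
def mixNorm (p q : ℝ) (I : Set ℝ) (u : ℝ → E3 → ℝ) : ℝ≥0∞ :=
  (∫⁻ t in I, (xNorm q (u t)) ^ p) ^ (1/p)

/-- The mixed norm `‖u‖_{L^∞_t L^q_x (I × ℝ³)}` (essential supremum in time). -/
def supNorm (q : ℝ) (I : Set ℝ) (u : ℝ → E3 → ℝ) : ℝ≥0∞ :=
  essSup (fun t => xNorm q (u t)) (volume.restrict I)

/-- The homogeneous Sobolev norm `‖f‖_{Ḣ^s} = (∫ |ξ|^{2s} |𝓕f(ξ)|² dξ)^{1/2}`. -/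
def sobNorm (s : ℝ) (f : E3 → ℝ) : ℝ≥0∞ :=
  (∫⁻ ξ : E3, (‖ξ‖₊ : ℝ≥0∞) ^ (2*s) *
    (‖𝓕 (fun x => (f x : ℂ)) ξ‖₊ : ℝ≥0∞) ^ (2:ℝ)) ^ ((1:ℝ)/2)

/-- The a priori bounds with constant `A`:
`‖u(t)‖_{L²} ≤ A`, `‖∂ₜu(t)‖_{Ḣ⁻¹} ≤ A`, `‖u(t)‖_{Ḣ²} ≤ A`, `‖∂ₜu(t)‖_{Ḣ¹} ≤ A` for all `t`. -/
def APriori (u : ℝ → E3 → ℝ) (A : ℝ) : Prop :=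
  ∀ t : ℝ, xNorm 2 (u t) ≤ ENNReal.ofReal A ∧ sobNorm (-1) (tderiv u t) ≤ ENNReal.ofReal A ∧
    sobNorm 2 (u t) ≤ ENNReal.ofReal A ∧ sobNorm 1 (tderiv u t) ≤ ENNReal.ofReal A

/-- The integral of `f` over the sphere of radius `r` about `x`, with respect to
two-dimensional Hausdorff (surface) measure. -/
def sphInt (x : E3) (r : ℝ) (f : E3 → ℝ) : ℝ := ∫ y in Metric.sphere x r, f y ∂(μH[2])

/-- The free wave evolution `S(t)(g, h)` given by Kirchhoff's formula. -/
def freeWave (g h : E3 → ℝ) (t : ℝ) (x : E3) : ℝ :=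
  if t = 0 then g x
  else deriv (fun s => (1/(4*π*s)) * sphInt x s g) t + (1/(4*π*t)) * sphInt x t h

/-- The Duhamel integral `D_{[s₁,s₂]}u(t,x) = ∫_{s₁}^{s₂} S(t−τ)(0, u(τ)⁵) dτ`,
written via Kirchhoff's formula. -/
def duh (u : ℝ → E3 → ℝ) (s₁ s₂ : ℝ) (t : ℝ) (x : E3) : ℝ :=
  ∫ τ in s₁..s₂, (1/(4*π*(t - τ))) * sphInt x (t - τ) (fun y => (u τ y) ^ 5)

/-- The `i`-th standard basis vector of `ℝ³`. -/
def bvec (i : Fin 3) : E3 := EuclideanSpace.single i 1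

/-- The `i`-th spatial derivative `∂ᵢ u` of a function `u : ℝ × ℝ³ → ℝ` (curried). -/
def sderiv (i : Fin 3) (u : ℝ → E3 → ℝ) (t : ℝ) (x : E3) : ℝ := fderiv ℝ (u t) x (bvec i)

/-- Joint smoothness of a curried function of time and space. -/
def Smooth2 (u : ℝ → E3 → ℝ) : Prop := ContDiff ℝ (⊤ : ℕ∞) (uncurry u)

theorem sum_coord_bvec (v : E3) : ∑ i, v i • bvec i = v := by
  ext j
  simp [bvec, Finset.sum_apply, Pi.single_apply]

theorem sum_coord_apply (L : E3 →L[ℝ] ℝ) (v : E3) : ∑ i, v i * L (bvec i) = L v := by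
  conv_rhs => rw [← sum_coord_bvec v]
  simp

theorem gradient_coord (f : E3 → ℝ) (x : E3) (i : Fin 3) :
    gradient f x i = fderiv ℝ f x (bvec i) := by
  have h : inner ℝ (gradient f x) (bvec i) = fderiv ℝ f x (bvec i) := by
    rw [gradient, InnerProductSpace.toDual_symm_apply]
  rw [← h, bvec, EuclideanSpace.inner_single_right]
  simp

theorem norm_gradient_sq (f : E3 → ℝ) (x : E3) :
    ‖gradient f x‖ ^ 2 = ∑ i, (fderiv ℝ f x (bvec i)) ^ 2 := by
  rw [EuclideanSpace.norm_sq_eq]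
  simp [gradient_coord]

theorem norm_gradient (f : E3 → ℝ) (x : E3) : ‖gradient f x‖ = ‖fderiv ℝ f x‖ := by
  simp [gradient]

theorem HasFDerivAt.partials {F : ℝ × E3 → ℝ} {F' : ℝ × E3 →L[ℝ] ℝ} {t : ℝ} {x : E3}
    (h : HasFDerivAt F F' (t, x)) :
    HasDerivAt (fun s => F (s, x)) (F' (1, 0)) t ∧
      HasFDerivAt (fun y => F (t, y)) (F'.comp (ContinuousLinearMap.inr ℝ ℝ E3)) x := by
  constructor
  · have h2 : HasDerivAt (fun s : ℝ => (s, x)) ((1 : ℝ), (0 : E3)) t :=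
      (hasDerivAt_id t).prodMk (hasDerivAt_const t x)
    exact h.comp_hasDerivAt t h2
  · exact h.comp x (hasFDerivAt_prodMk_right t x)

namespace Smooth2

variable {u : ℝ → E3 → ℝ}

theorem hasFDerivAt (h : Smooth2 u) (p : ℝ × E3) :
    HasFDerivAt (uncurry u) (fderiv ℝ (uncurry u) p) p :=
  ((h.differentiable (by simp)) p).hasFDerivAt

theorem tderiv_eq (h : Smooth2 u) (t : ℝ) (x : E3) :
    tderiv u t x = fderiv ℝ (uncurry u) (t, x) (1, 0) :=
  (h.hasFDerivAt (t, x)).partials.1.deriv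

theorem fderiv_eq (h : Smooth2 u) (t : ℝ) (x : E3) :
    fderiv ℝ (u t) x =
      (fderiv ℝ (uncurry u) (t, x)).comp (ContinuousLinearMap.inr ℝ ℝ E3) :=
  (h.hasFDerivAt (t, x)).partials.2.fderiv

theorem sderiv_eq (h : Smooth2 u) (i : Fin 3) (t : ℝ) (x : E3) :
    sderiv i u t x = fderiv ℝ (uncurry u) (t, x) (0, bvec i) := by
  simp [sderiv, h.fderiv_eq]

theorem slice (h : Smooth2 u) (t : ℝ) : ContDiff ℝ (⊤ : ℕ∞) (u t) :=
  ContDiff.comp (f := fun x : E3 => (t, x)) h (by fun_prop)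

theorem contDiff_fderiv_apply (h : Smooth2 u) (v : ℝ × E3) :
    ContDiff ℝ (⊤ : ℕ∞) (fun p => fderiv ℝ (uncurry u) p v) :=
  (h.fderiv_right (m := (⊤ : ℕ∞)) (by norm_cast)).clm_apply contDiff_const

theorem smooth_tderiv (h : Smooth2 u) : Smooth2 (tderiv u) := by
  have := h.contDiff_fderiv_apply (1, 0)
  rwa [Smooth2, show uncurry (tderiv u) = _ from funext fun p => h.tderiv_eq p.1 p.2]

theorem smooth_sderiv (h : Smooth2 u) (i : Fin 3) : Smooth2 (sderiv i u) := by
  have := h.contDiff_fderiv_apply (0, bvec i)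
  rwa [Smooth2, show uncurry (sderiv i u) = _ from funext fun p => h.sderiv_eq i p.1 p.2]

theorem hasDerivAt (h : Smooth2 u) (t : ℝ) (x : E3) :
    HasDerivAt (fun s => u s x) (tderiv u t x) t := by
  rw [h.tderiv_eq]
  exact (h.hasFDerivAt (t, x)).partials.1

theorem hasLineDerivAt (h : Smooth2 u) (i : Fin 3) (t : ℝ) (x : E3) :
    HasLineDerivAt ℝ (u t) (sderiv i u t x) x (bvec i) :=
  (((h.slice t).differentiable (by simp)) x).hasFDerivAt.hasLineDerivAt _

theorem fderiv_comm (h : Smooth2 u) (p v w : ℝ × E3) :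
    fderiv ℝ (fun q => fderiv ℝ (uncurry u) q v) p w =
      fderiv ℝ (fun q => fderiv ℝ (uncurry u) q w) p v := by
  have hs : IsSymmSndFDerivAt ℝ (uncurry u) p :=
    (ContDiff.contDiffAt h).isSymmSndFDerivAt (by
      rw [minSmoothness_of_isRCLikeNormedField]
      exact WithTop.coe_le_coe.2 (le_top : (2 : ℕ∞) ≤ ⊤))
  have hd : DifferentiableAt ℝ (fderiv ℝ (uncurry u)) p :=
    ((h.fderiv_right (m := (⊤ : ℕ∞)) (by norm_cast)).differentiable (by simp)) p
  rw [fderiv_clm_apply hd (by fun_prop), fderiv_clm_apply hd (by fun_prop)]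
  simpa using hs w v

theorem uncurry_tderiv (h : Smooth2 u) :
    uncurry (tderiv u) = fun q => fderiv ℝ (uncurry u) q (1, 0) :=
  funext fun p => h.tderiv_eq p.1 p.2

theorem uncurry_sderiv (h : Smooth2 u) (i : Fin 3) :
    uncurry (sderiv i u) = fun q => fderiv ℝ (uncurry u) q (0, bvec i) :=
  funext fun p => h.sderiv_eq i p.1 p.2

theorem tderiv_sderiv (h : Smooth2 u) (i : Fin 3) (t : ℝ) (x : E3) :
    tderiv (sderiv i u) t x = sderiv i (tderiv u) t x := by
  rw [(h.smooth_sderiv i).tderiv_eq, h.smooth_tderiv.sderiv_eq, h.uncurry_tderiv, h.uncurry_sderiv,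
    h.fderiv_comm]

theorem sderiv_comm (h : Smooth2 u) (i j : Fin 3) (t : ℝ) (x : E3) :
    sderiv i (sderiv j u) t x = sderiv j (sderiv i u) t x := by
  rw [(h.smooth_sderiv i).sderiv_eq, (h.smooth_sderiv j).sderiv_eq, h.uncurry_sderiv, h.uncurry_sderiv,
    h.fderiv_comm]

theorem lap_eq (h : Smooth2 u) (t : ℝ) (x : E3) :
    lap (u t) x = ∑ i, sderiv i (sderiv i u) t x := by
  unfold lap
  refine Finset.sum_congr rfl fun i _ => ?_
  have hd : DifferentiableAt ℝ (fderiv ℝ (u t)) x :=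
    (((h.slice t).fderiv_right (m := (⊤ : ℕ∞)) (by norm_cast)).differentiable (by simp)) x
  rw [iteratedFDeriv_two_apply]
  simp only [Matrix.cons_val_zero, Matrix.cons_val_one]
  change _ = fderiv ℝ (fun y => fderiv ℝ (u t) y (bvec i)) x (bvec i)
  rw [fderiv_clm_apply hd (by fun_prop)]
  simp [bvec]

theorem continuous (h : Smooth2 u) : Continuous (uncurry u) := ContDiff.continuous h

theorem norm_gradient_sq (t : ℝ) (x : E3) :
    ‖gradient (u t) x‖ ^ 2 = ∑ i, sderiv i u t x ^ 2 := by
  rw [_root_.norm_gradient_sq]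
  rfl

end Smooth2

theorem integral_lineDeriv_eq_zero {V : Type*} [NormedAddCommGroup V] [NormedSpace ℝ V]
    [FiniteDimensional ℝ V] [MeasurableSpace V] [BorelSpace V] {μ : Measure V}
    [μ.IsAddHaarMeasure] {f f' : V → ℝ} {v : V} (hf : Integrable f μ) (hf' : Integrable f' μ)
    (h : ∀ x, HasLineDerivAt ℝ f (f' x) x v) : ∫ x, f' x ∂μ = 0 := by
  have key := integral_bilinear_hasLineDerivAt_right_eq_neg_left_of_integrable (μ := μ)
    (f := fun _ => (1 : ℝ)) (f' := fun _ => 0) (g := f) (g' := f') (v := v)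
    (B := ContinuousLinearMap.mul ℝ ℝ) (by simp) (by simpa using hf') (by simpa using hf)
    (fun x _ => by simpa [HasLineDerivAt] using hasDerivAt_const (0 : ℝ) (1 : ℝ))
    (fun x _ => h x)
  simpa using key

theorem hasDerivAt_integral_of_compact {V : Type*} [TopologicalSpace V] [MeasurableSpace V]
    [OpensMeasurableSpace V] [T2Space V] {μ : Measure V} [IsFiniteMeasureOnCompacts μ]
    {D D' : ℝ → V → ℝ} {K : Set V} (hK : IsCompact K)
    (hD : ∀ t, Continuous (D t)) (hD' : Continuous (uncurry D'))
    (h0 : ∀ t, ∀ p ∉ K, D t p = 0) (h0' : ∀ t, ∀ p ∉ K, D' t p = 0)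
    (h : ∀ t p, HasDerivAt (fun s => D s p) (D' t p) t) (t : ℝ) :
    HasDerivAt (fun s => ∫ p, D s p ∂μ) (∫ p, D' t p ∂μ) t := by
  obtain ⟨B, hB⟩ := ((isCompact_closedBall t 1).prod hK).exists_bound_of_continuousOn
    hD'.continuousOn
  have hcs : ∀ {g : V → ℝ}, (∀ p ∉ K, g p = 0) → HasCompactSupport g :=
    fun hg => HasCompactSupport.intro hK hg
  refine (hasDerivAt_integral_of_dominated_loc_of_deriv_le (F := D) (F' := D')
    (bound := K.indicator fun _ => B) (Metric.closedBall_mem_nhds t one_pos)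
    (Filter.Eventually.of_forall fun s =>
      ((hD s).integrable_of_hasCompactSupport (hcs (h0 s))).aestronglyMeasurable)
    ((hD t).integrable_of_hasCompactSupport (hcs (h0 t)))
    ((Continuous.integrable_of_hasCompactSupport (f := D' t) (by fun_prop)
      (hcs (h0' t))).aestronglyMeasurable)
    (Filter.Eventually.of_forall fun p s hs => ?_) ?_
    (Filter.Eventually.of_forall fun p s _ => h s p)).2
  · by_cases hp : p ∈ K
    · simpa [hp] using hB (s, p) ⟨hs, hp⟩
    · simp [hp, h0' s p hp]
  · exact (integrable_indicator_iff hK.measurableSet).2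
      (integrableOn_const (hK.measure_lt_top.ne))

theorem IsSchwartz.integrable_pow {f : E3 → ℝ} (h : IsSchwartz f) {n : ℕ} (hn : n ≠ 0) :
    Integrable fun x => |f x| ^ n := by
  let g : SchwartzMap E3 ℝ := ⟨f, h.1, h.2⟩
  exact (g.memLp (n : ℝ≥0∞)).integrable_norm_pow hn

theorem IsSchwartz.integrable_sq {f : E3 → ℝ} (h : IsSchwartz f) :
    Integrable fun x => f x ^ 2 := by
  simpa using h.integrable_pow two_ne_zero

theorem IsSchwartz.integrable_fderiv_sq {f : E3 → ℝ} (h : IsSchwartz f) :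
    Integrable fun x => ‖fderiv ℝ f x‖ ^ 2 := by
  let g : SchwartzMap E3 ℝ := ⟨f, h.1, h.2⟩
  exact ((SchwartzMap.fderivCLM ℝ E3 ℝ g).memLp (2 : ℝ≥0∞)).integrable_norm_pow two_ne_zero

/-- The regularised inverse square weight `(|x - y|² + ρ²)⁻¹`. -/
def hardyWeight (ρ : ℝ) (y x : E3) : ℝ := (‖x - y‖ ^ 2 + ρ ^ 2)⁻¹

theorem hardyWeight_pos {ρ : ℝ} (hρ : 0 < ρ) (y x : E3) : 0 < hardyWeight ρ y x := by
  unfold hardyWeight; positivity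

theorem hardyWeight_le {ρ : ℝ} (hρ : 0 < ρ) (y x : E3) : hardyWeight ρ y x ≤ (ρ ^ 2)⁻¹ :=
  inv_anti₀ (by positivity) (by nlinarith [sq_nonneg ‖x - y‖])

theorem norm_sq_mul_hardyWeight_le {ρ : ℝ} (hρ : 0 < ρ) (y x : E3) :
    ‖x - y‖ ^ 2 * hardyWeight ρ y x ≤ 1 := by
  unfold hardyWeight
  rw [← div_eq_mul_inv, div_le_one (by positivity)]
  nlinarith [sq_nonneg ρ]

theorem continuous_hardyWeight {ρ : ℝ} (hρ : 0 < ρ) :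
    Continuous fun p : E3 × E3 => hardyWeight ρ p.2 p.1 := by
  unfold hardyWeight
  exact Continuous.inv₀ (by fun_prop) fun p => by positivity

theorem hasLineDerivAt_coord (i j : Fin 3) (x y : E3) :
    HasLineDerivAt ℝ (fun x : E3 => x i - y i) (if i = j then 1 else 0) x (bvec j) := by
  have h : HasFDerivAt (fun x : E3 => x i - y i)
      (EuclideanSpace.proj i : E3 →L[ℝ] ℝ) x :=
    (EuclideanSpace.proj i : E3 →L[ℝ] ℝ).hasFDerivAt.sub_const _
  convert! h.hasLineDerivAt (bvec j) using 1
  simp [bvec]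

theorem hasLineDerivAt_hardyWeight {ρ : ℝ} (hρ : 0 < ρ) (i : Fin 3) (x y : E3) :
    HasLineDerivAt ℝ (hardyWeight ρ y) (-(2 * (x i - y i)) * hardyWeight ρ y x ^ 2) x
      (bvec i) := by
  have h1 : HasFDerivAt (fun x : E3 => ‖x - y‖ ^ 2 + ρ ^ 2)
      (2 • (innerSL ℝ (x - y)).comp (ContinuousLinearMap.id ℝ E3)) x :=
    (((hasFDerivAt_id x).sub_const y).norm_sq).add_const _
  have h2 := (h1.hasLineDerivAt (bvec i)).inv (c := fun t : ℝ => _) (by simp; positivity)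
  unfold HasLineDerivAt hardyWeight
  convert! h2 using 1
  simp [bvec, EuclideanSpace.inner_single_right]
  field_simp

theorem IsSchwartz.hardy {f : E3 → ℝ} (h : IsSchwartz f) {ρ : ℝ} (hρ : 0 < ρ) (y : E3) :
    ∫ x, f x ^ 2 * hardyWeight ρ y x ≤ 4 * ∫ x, ‖fderiv ℝ f x‖ ^ 2 := by
  have hfd : Differentiable ℝ f := h.1.differentiable (by simp)
  have hfc : Continuous f := hfd.continuous
  have hf'c : Continuous (fderiv ℝ f) := h.1.continuous_fderiv (by simp)
  have hwc : Continuous (hardyWeight ρ y) :=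
    (continuous_hardyWeight hρ).comp (f := fun x => (x, y)) (by fun_prop)
  have i1 := h.integrable_sq
  have i2 := h.integrable_fderiv_sq
  have iw : Integrable fun x => f x ^ 2 * hardyWeight ρ y x :=
    (i1.mul_const (ρ ^ 2)⁻¹).mono' (by fun_prop) (Filter.Eventually.of_forall fun x => by
      have := hardyWeight_pos hρ y x
      rw [Real.norm_of_nonneg (by positivity)]
      gcongr
      exact hardyWeight_le hρ y x)
  set D : Fin 3 → E3 → ℝ := fun i x =>
    (2 * f x * fderiv ℝ f x (bvec i)) * ((x i - y i) * hardyWeight ρ y x) +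
      f x ^ 2 * (1 * hardyWeight ρ y x +
        (x i - y i) * (-(2 * (x i - y i)) * hardyWeight ρ y x ^ 2)) with hD
  have hb : ∀ i, ‖bvec i‖ = 1 := fun i => by simp [bvec]
  have hc : ∀ i x, |x i - y i| ≤ ‖x - y‖ := fun i x => by
    simpa using PiLp.norm_apply_le (x - y) i
  have hsq : ∀ i x, (x i - y i) ^ 2 * hardyWeight ρ y x ≤ 1 := fun i x => by
    refine le_trans ?_ (norm_sq_mul_hardyWeight_le hρ y x)
    have := hardyWeight_pos hρ y x
    refine mul_le_mul_of_nonneg_right (sq_le_sq.2 ?_) this.le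
    rw [abs_norm]
    exact hc i x
  have hline : ∀ i x, HasLineDerivAt ℝ
      (fun x => f x ^ 2 * ((x i - y i) * hardyWeight ρ y x)) (D i x) x (bvec i) := by
    intro i x
    have e1 := ((hfd x).hasFDerivAt.hasLineDerivAt (bvec i))
    have e2 := hasLineDerivAt_coord i i x y
    have e3 := hasLineDerivAt_hardyWeight hρ i x y
    unfold HasLineDerivAt at *
    convert! (e1.pow 2).mul (e2.mul e3) using 1
    simp [hD]
  have iX : ∀ i, Integrable fun x => f x ^ 2 * ((x i - y i) * hardyWeight ρ y x) := by
    intro i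
    refine (i1.mul_const (1 + (ρ ^ 2)⁻¹)).mono' (by fun_prop)
      (Filter.Eventually.of_forall fun x => ?_)
    rw [norm_mul, norm_of_nonneg (sq_nonneg (f x))]
    gcongr
    have h1 := hardyWeight_pos hρ y x
    have h2 := hardyWeight_le hρ y x
    have h3 := hsq i x
    rw [norm_mul, norm_of_nonneg h1.le, Real.norm_eq_abs]
    have h4 := sq_abs (x i - y i)
    nlinarith [sq_nonneg (|x i - y i| - 1)]
  have iD : ∀ i, Integrable (D i) := by
    intro i
    refine (((i1.add i2).mul_const (1 + (ρ ^ 2)⁻¹)).add (i1.mul_const (3 * (ρ ^ 2)⁻¹))).mono'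
      (by fun_prop) (Filter.Eventually.of_forall fun x => ?_)
    have h1 := hardyWeight_pos hρ y x
    have h2 := hardyWeight_le hρ y x
    have h3 := hsq i x
    have h4 := sq_abs (x i - y i)
    have h5 : |(x i - y i) * hardyWeight ρ y x| ≤ 1 + (ρ ^ 2)⁻¹ := by
      rw [abs_mul, abs_of_pos h1]
      nlinarith [sq_nonneg (|x i - y i| - 1)]
    have h6 : |2 * f x * fderiv ℝ f x (bvec i)| ≤ f x ^ 2 + ‖fderiv ℝ f x‖ ^ 2 := by
      have := (fderiv ℝ f x).le_opNorm (bvec i)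
      rw [hb, mul_one, Real.norm_eq_abs] at this
      rw [abs_mul, abs_mul, abs_two]
      nlinarith [sq_nonneg (|f x| - ‖fderiv ℝ f x‖), sq_abs (f x), abs_nonneg (f x)]
    have h7 : |1 * hardyWeight ρ y x +
        (x i - y i) * (-(2 * (x i - y i)) * hardyWeight ρ y x ^ 2)| ≤ 3 * (ρ ^ 2)⁻¹ := by
      have h8 : 0 ≤ (x i - y i) ^ 2 * hardyWeight ρ y x := by positivity
      rw [abs_le]
      constructor <;> nlinarith
    refine (norm_add_le _ _).trans ?_
    simp only [norm_mul, Real.norm_eq_abs] at *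
    simp only [Pi.add_apply]
    rw [abs_mul] at h5
    simp only [abs_mul] at h6
    gcongr
    exact le_of_eq (abs_of_nonneg (sq_nonneg _))
  have hzero : ∫ x, ∑ i, D i x = 0 := by
    rw [integral_finsetSum _ fun i _ => iD i]
    exact Finset.sum_eq_zero fun i _ => integral_lineDeriv_eq_zero (iX i) (iD i) (hline i)
  have hpt : ∀ x, (1 / 2) * (f x ^ 2 * hardyWeight ρ y x) - 2 * ‖fderiv ℝ f x‖ ^ 2
      ≤ ∑ i, D i x := by
    intro x
    have h1 := hardyWeight_pos hρ y x
    have h3 := norm_sq_mul_hardyWeight_le hρ y x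
    have hs : ∑ i, (x i - y i) * fderiv ℝ f x (bvec i) = fderiv ℝ f x (x - y) := by
      simpa using sum_coord_apply (fderiv ℝ f x) (x - y)
    have hn : ∑ i, (x i - y i) ^ 2 = ‖x - y‖ ^ 2 := by
      rw [EuclideanSpace.norm_sq_eq]; simp
    have hsum : ∑ i, D i x = 2 * f x * hardyWeight ρ y x * fderiv ℝ f x (x - y) +
        f x ^ 2 * hardyWeight ρ y x * (3 - 2 * (‖x - y‖ ^ 2 * hardyWeight ρ y x)) := by
      rw [← hs, ← hn]
      simp only [hD, Fin.sum_univ_three]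
      ring
    rw [hsum]
    have hop := (fderiv ℝ f x).le_opNorm (x - y)
    rw [Real.norm_eq_abs] at hop
    set w := hardyWeight ρ y x
    set g := ‖fderiv ℝ f x‖
    set r := ‖x - y‖
    have hg : 0 ≤ g := norm_nonneg _
    have hr : 0 ≤ r := norm_nonneg _
    have a1 : 2 * (|f x| * w * (g * r)) ≤ (1 / 2) * (f x ^ 2 * w) + 2 * g ^ 2 := by
      have : 0 ≤ w * (|f x| - 2 * (g * r)) ^ 2 := by positivity
      have : g ^ 2 * (r ^ 2 * w) ≤ g ^ 2 * 1 := by gcongr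
      nlinarith [sq_abs (f x)]
    have a2 : -(|f x| * w * (g * r)) ≤ f x * w * fderiv ℝ f x (x - y) := by
      refine (neg_le_neg ?_).trans (neg_abs_le _)
      rw [abs_mul, abs_mul, abs_of_pos h1]
      gcongr
    have a3 : f x ^ 2 * w * 1 ≤ f x ^ 2 * w * (3 - 2 * (r ^ 2 * w)) := by
      gcongr
      linarith
    nlinarith
  have := integral_mono ((iw.const_mul (1 / 2)).sub (i2.const_mul 2))
    (integrable_finsetSum _ fun i _ => iD i) hpt
  simp only [Pi.sub_apply] at this
  rw [hzero, integral_sub (iw.const_mul _) (i2.const_mul _), integral_const_mul,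
    integral_const_mul] at this
  linarith

theorem abs_sum_mul_le {ι : Type*} [Fintype ι] (f g : ι → ℝ) :
    |∑ i, f i * g i| ≤ √(∑ i, f i ^ 2) * √(∑ i, g i ^ 2) := by
  rw [abs_le]
  constructor
  · have := Real.sum_mul_le_sqrt_mul_sqrt Finset.univ (fun i => -f i) g
    simp only [neg_mul, Finset.sum_neg_distrib, neg_sq] at this
    linarith
  · exact Real.sum_mul_le_sqrt_mul_sqrt Finset.univ f g

/-- The algebraic identity behind the interaction Morawetz estimate: after removing the
divergences in `x` and in `y`, the time derivative of the interaction density is a signed term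
plus errors carrying a derivative of the kernel `ψ` or of the cutoff `χ`. Primed variables
refer to the point `y`, unprimed ones to `x`, and `z = x - y`. -/
theorem morawetz_identity (ψ χ u ut utt u' ut' utt' : ℝ) (dψ dχ z us uts us' uts' : Fin 3 → ℝ)
    (uss uss' : Fin 3 → Fin 3 → ℝ) (hsymm : ∀ i j, uss i j = uss j i)
    (hpde : utt - ∑ i, uss i i + u ^ 5 = 0) (hpde' : utt' - ∑ i, uss' i i + u' ^ 5 = 0) :
    (ψ * χ * (utt * (∑ k, z k * us k) + ut * (∑ k, z k * uts k) + (utt * u + ut * ut)) *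
        ((1 / 2) * ut' ^ 2 + (1 / 2) * (∑ k, us' k ^ 2) + (1 / 6) * u' ^ 6) +
      ψ * χ * (ut * (∑ k, z k * us k) + ut * u) *
        (ut' * utt' + (∑ k, us' k * uts' k) + u' ^ 5 * ut')) -
      (∑ i, χ * ((1 / 2) * ut' ^ 2 + (1 / 2) * (∑ k, us' k ^ 2) + (1 / 6) * u' ^ 6) *
        ((dψ i * us i + ψ * uss i i) * ((∑ k, z k * us k) + u) +
          ψ * us i * ((us i + ∑ k, z k * uss i k) + us i) +
          ((dψ i * z i + ψ) * ((1 / 2) * ut ^ 2 - (1 / 2) * (∑ k, us k ^ 2) - (1 / 6) * u ^ 6) +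
            ψ * z i * (ut * uts i - (∑ k, us k * uss i k) - u ^ 5 * us i)))) -
      (∑ i, ((-dψ i * χ + ψ * dχ i) * (ut * (∑ k, z k * us k) + ut * u) * (ut' * us' i) +
          ψ * χ * (-(ut * us i)) * (ut' * us' i) +
          ψ * χ * (ut * (∑ k, z k * us k) + ut * u) * (uts' i * us' i + ut' * uss' i i))) =
    -(ψ * χ * ((1 / 2) * ut ^ 2 + (1 / 2) * (∑ k, us k ^ 2) + (1 / 2) * u ^ 6) *
        ((1 / 2) * ut' ^ 2 + (1 / 2) * (∑ k, us' k ^ 2) + (1 / 6) * u' ^ 6)) +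
      ψ * χ * (ut * ut' * ∑ k, us k * us' k) +
      χ * ((1 / 2) * ut' ^ 2 + (1 / 2) * (∑ k, us' k ^ 2) + (1 / 6) * u' ^ 6) *
        (-(∑ k, dψ k * us k) * (∑ k, z k * us k) +
          (1 / 2) * (∑ k, z k * dψ k) * ((∑ k, us k ^ 2) - ut ^ 2 + (1 / 3) * u ^ 6) -
          u * ∑ k, dψ k * us k) +
      ut' * ((∑ k, us' k * dψ k) * χ - (∑ k, us' k * dχ k) * ψ) *
        (ut * (∑ k, z k * us k) + ut * u) := by
  have h1 : utt = ∑ i, uss i i - u ^ 5 := by linarith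
  have h2 : utt' = ∑ i, uss' i i - u' ^ 5 := by linarith
  rw [h1, h2]
  simp only [Fin.sum_univ_three]
  rw [hsymm 1 0, hsymm 2 0, hsymm 2 1]
  ring

/-- Pointwise size of the interaction density. -/
theorem morawetz_density_le {ψ u ut g b r ρ k AT : ℝ} (hψ : 0 ≤ ψ) (hg : 0 ≤ g)
    (hρ : 0 ≤ ρ) (hk : 0 ≤ k) (hb : |b| ≤ r * g) (hu : |u| ≤ k * (r + ρ))
    (hψA : ψ * (r + ρ) ≤ AT) (hr : 0 ≤ r) :
    ψ * |ut * b + ut * u| ≤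
      2 * AT * ((1 / 2) * ut ^ 2 + (1 / 2) * g ^ 2 + (1 / 6) * u ^ 6 + k ^ 2) := by
  have hAT : 0 ≤ AT := le_trans (by positivity) hψA
  have h1 : |ut * b + ut * u| ≤ |ut| * (r * g) + |ut| * (k * (r + ρ)) := by
    refine (abs_add_le _ _).trans ?_
    rw [abs_mul, abs_mul]
    gcongr
  have h2 : |ut| * (r * g) + |ut| * (k * (r + ρ)) ≤ (r + ρ) * (|ut| * (g + k)) := by
    nlinarith [mul_nonneg (mul_nonneg hρ (abs_nonneg ut)) hg]
  have h3 : |ut| * (g + k) ≤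
      2 * ((1 / 2) * ut ^ 2 + (1 / 2) * g ^ 2 + (1 / 6) * u ^ 6 + k ^ 2) := by
    have : 0 ≤ u ^ 6 := by positivity
    nlinarith [sq_abs ut, sq_nonneg (|ut| - g), sq_nonneg (|ut| - 2 * k), sq_nonneg (|ut| - k)]
  calc ψ * |ut * b + ut * u| ≤ ψ * ((r + ρ) * (|ut| * (g + k))) := by
        gcongr; exact h1.trans h2
    _ = (ψ * (r + ρ)) * (|ut| * (g + k)) := by ring
    _ ≤ AT * (2 * ((1 / 2) * ut ^ 2 + (1 / 2) * g ^ 2 + (1 / 6) * u ^ 6 + k ^ 2)) := by gcongr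
    _ = _ := by ring

/-- The signed term controls the integrand of the interaction Morawetz estimate, and the error
terms are controlled by the kernel bounds. -/
theorem morawetz_pointwise {ψ χ u ut u' ut' g g' a a' b c c' d r q s ρ k A T : ℝ}
    (hψ : 0 ≤ ψ) (hχ : 0 ≤ χ) (hχ1 : χ ≤ 1) (hg : 0 ≤ g) (hg' : 0 ≤ g') (hr : 0 ≤ r)
    (hq : 0 ≤ q) (hs : 0 ≤ s) (hρ : 0 ≤ ρ) (hk : 0 ≤ k)
    (ha : |a| ≤ q * g) (ha' : |a'| ≤ g' * q) (hb : |b| ≤ r * g) (hc : |c| ≤ r * q)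
    (hc' : |c'| ≤ g' * s) (hd : |d| ≤ g * g') (hu : |u| ≤ k * (r + ρ))
    (hqA : q * (r + ρ) ≤ A) (hψA : ψ * (r + ρ) ≤ A * T) (hsT : T * s ≤ 1) :
    -(ψ * χ * ((1 / 2) * ut ^ 2 + (1 / 2) * g ^ 2 + (1 / 2) * u ^ 6) *
        ((1 / 2) * ut' ^ 2 + (1 / 2) * g' ^ 2 + (1 / 6) * u' ^ 6)) +
      ψ * χ * (ut * ut' * d) +
      χ * ((1 / 2) * ut' ^ 2 + (1 / 2) * g' ^ 2 + (1 / 6) * u' ^ 6) *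
        (-a * b + (1 / 2) * c * (g ^ 2 - ut ^ 2 + (1 / 3) * u ^ 6) - u * a) +
      ut' * (a' * χ - c' * ψ) * (ut * b + ut * u) ≤
    -(1 / 4) * (ψ * χ * (((1 / 2) * (|ut| - g) ^ 2 + (1 / 6) * u ^ 6) *
        ((1 / 2) * ut' ^ 2 + (1 / 2) * g' ^ 2 + (2 / 3) * u' ^ 6))) +
      8 * A * (((1 / 2) * ut' ^ 2 + (1 / 2) * g' ^ 2 + (1 / 6) * u' ^ 6) *
        ((1 / 2) * ut ^ 2 + (1 / 2) * g ^ 2 + (1 / 6) * u ^ 6 + k ^ 2)) := by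
  have hA : 0 ≤ A := le_trans (by positivity) hqA
  have hu6 : 0 ≤ u ^ 6 := by positivity
  have hu6' : 0 ≤ u' ^ 6 := by positivity
  obtain ⟨e, he⟩ : ∃ e, e = (1 / 2) * ut ^ 2 + (1 / 2) * g ^ 2 + (1 / 6) * u ^ 6 := ⟨_, rfl⟩
  obtain ⟨e', he'⟩ : ∃ e, e = (1 / 2) * ut' ^ 2 + (1 / 2) * g' ^ 2 + (1 / 6) * u' ^ 6 := ⟨_, rfl⟩
  rw [← he, ← he']
  have he0 : 0 ≤ e := by rw [he]; positivity
  have he0' : 0 ≤ e' := by rw [he']; positivity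
  have hm := morawetz_density_le (ut := ut) hψ hg hρ hk hb hu hψA hr
  have hmq := morawetz_density_le (ut := ut) hq hg hρ hk hb hu hqA hr
  rw [← he] at hm hmq
  generalize ut * b + ut * u = m at hm hmq ⊢
  have hte : |ut'| * g' ≤ e' := by
    rw [he']
    linarith [sq_abs ut', sq_nonneg (|ut'| - g')]
  have hF : (1 / 2) * (|ut| - g) ^ 2 + (1 / 6) * u ^ 6 = e - |ut| * g := by
    rw [he]
    linarith [sq_abs ut]
  have hF0 : 0 ≤ e - |ut| * g := by rw [← hF]; positivity
  -- the signed part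
  have p1 : ut * ut' * d ≤ (|ut| * g) * e' := by
    calc ut * ut' * d ≤ |ut * ut' * d| := le_abs_self _
      _ = |ut| * |ut'| * |d| := by rw [abs_mul, abs_mul]
      _ ≤ |ut| * |ut'| * (g * g') := by gcongr
      _ = (|ut| * g) * (|ut'| * g') := by ring
      _ ≤ (|ut| * g) * e' := by gcongr
  have p2 : (1 / 4) * ((e - |ut| * g) * ((1 / 2) * ut' ^ 2 + (1 / 2) * g' ^ 2 + (2 / 3) * u' ^ 6))
      ≤ (e - |ut| * g) * e' := by
    have : (1 / 4) * ((1 / 2) * ut' ^ 2 + (1 / 2) * g' ^ 2 + (2 / 3) * u' ^ 6) ≤ e' := by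
      rw [he']
      linarith [sq_nonneg ut', sq_nonneg g']
    have h := mul_le_mul_of_nonneg_left this hF0
    linarith
  have p3 : e * e' ≤ ((1 / 2) * ut ^ 2 + (1 / 2) * g ^ 2 + (1 / 2) * u ^ 6) * e' := by
    gcongr
    rw [he]
    linarith
  have p4 : -(ψ * χ * ((1 / 2) * ut ^ 2 + (1 / 2) * g ^ 2 + (1 / 2) * u ^ 6) * e') +
      ψ * χ * (ut * ut' * d) ≤ -(1 / 4) * (ψ * χ * (((1 / 2) * (|ut| - g) ^ 2 + (1 / 6) * u ^ 6) *
        ((1 / 2) * ut' ^ 2 + (1 / 2) * g' ^ 2 + (2 / 3) * u' ^ 6))) := by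
    rw [hF]
    have : 0 ≤ ψ * χ := by positivity
    have h1 := mul_le_mul_of_nonneg_left p1 this
    have h2 := mul_le_mul_of_nonneg_left p2 this
    have h3 := mul_le_mul_of_nonneg_left p3 this
    linarith
  -- errors from the derivative of the kernel in the `x` variable
  have hqr : r * q ≤ A := le_trans (by linarith [mul_nonneg hq hρ]) hqA
  have e1 : -a * b ≤ A * g ^ 2 := by
    calc -a * b ≤ |-a * b| := le_abs_self _
      _ = |a| * |b| := by rw [abs_mul, abs_neg]
      _ ≤ (q * g) * (r * g) := by gcongr
      _ = (r * q) * g ^ 2 := by ring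
      _ ≤ A * g ^ 2 := by gcongr
  have e2 : (1 / 2) * c * (g ^ 2 - ut ^ 2 + (1 / 3) * u ^ 6) ≤ A * e := by
    have h1 : |g ^ 2 - ut ^ 2 + (1 / 3) * u ^ 6| ≤ 2 * e := by
      rw [abs_le, he]
      constructor <;> linarith [sq_nonneg ut, sq_nonneg g]
    calc (1 / 2) * c * (g ^ 2 - ut ^ 2 + (1 / 3) * u ^ 6)
        ≤ |(1 / 2) * c * (g ^ 2 - ut ^ 2 + (1 / 3) * u ^ 6)| := le_abs_self _
      _ = (1 / 2) * |c| * |g ^ 2 - ut ^ 2 + (1 / 3) * u ^ 6| := by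
        rw [abs_mul, abs_mul, abs_of_pos (by norm_num : (0 : ℝ) < 1 / 2)]
      _ ≤ (1 / 2) * A * (2 * e) := by gcongr; exact hc.trans hqr
      _ = A * e := by ring
  have e3 : -(u * a) ≤ A * (k * g) := by
    calc -(u * a) ≤ |u * a| := neg_le_abs _
      _ = |u| * |a| := abs_mul _ _
      _ ≤ (k * (r + ρ)) * (q * g) := by gcongr
      _ = (q * (r + ρ)) * (k * g) := by ring
      _ ≤ A * (k * g) := by gcongr
  have e4 : -a * b + (1 / 2) * c * (g ^ 2 - ut ^ 2 + (1 / 3) * u ^ 6) - u * a ≤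
      4 * A * (e + k ^ 2) := by
    have : g ^ 2 + e + k * g ≤ 4 * (e + k ^ 2) := by
      rw [he]
      linarith [sq_nonneg ut, sq_nonneg (k - g), sq_nonneg k, sq_nonneg g]
    have h := mul_le_mul_of_nonneg_left this hA
    linarith
  have e5 : χ * e' * (-a * b + (1 / 2) * c * (g ^ 2 - ut ^ 2 + (1 / 3) * u ^ 6) - u * a) ≤
      e' * (4 * A * (e + k ^ 2)) := by
    calc _ ≤ χ * e' * (4 * A * (e + k ^ 2)) := by gcongr
      _ ≤ 1 * e' * (4 * A * (e + k ^ 2)) := by gcongr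
      _ = _ := by ring
  -- errors from the energy flux
  have f1 : |a' * χ - c' * ψ| * |m| ≤ g' * (4 * A * (e + k ^ 2)) := by
    have h1 : |a' * χ| * |m| ≤ g' * (2 * A * (e + k ^ 2)) := by
      rw [abs_mul, abs_of_nonneg hχ]
      calc |a'| * χ * |m| ≤ (g' * q) * 1 * |m| := by gcongr
        _ = g' * (q * |m|) := by ring
        _ ≤ _ := by gcongr
    have h2 : |c' * ψ| * |m| ≤ g' * (2 * A * (e + k ^ 2)) := by
      rw [abs_mul, abs_of_nonneg hψ]
      calc |c'| * ψ * |m| ≤ (g' * s) * ψ * |m| := by gcongr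
        _ = g' * s * (ψ * |m|) := by ring
        _ ≤ g' * s * (2 * (A * T) * (e + k ^ 2)) := by gcongr
        _ = (T * s) * (g' * (2 * A * (e + k ^ 2))) := by ring
        _ ≤ 1 * (g' * (2 * A * (e + k ^ 2))) := by gcongr
        _ = _ := one_mul _
    have h3 := mul_le_mul_of_nonneg_right (abs_sub (a' * χ) (c' * ψ)) (abs_nonneg m)
    linarith
  have f2 : ut' * (a' * χ - c' * ψ) * m ≤ e' * (4 * A * (e + k ^ 2)) := by
    calc ut' * (a' * χ - c' * ψ) * m ≤ |ut' * (a' * χ - c' * ψ) * m| := le_abs_self _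
      _ = |ut'| * (|a' * χ - c' * ψ| * |m|) := by rw [abs_mul, abs_mul, mul_assoc]
      _ ≤ |ut'| * (g' * (4 * A * (e + k ^ 2))) := by gcongr
      _ = (|ut'| * g') * (4 * A * (e + k ^ 2)) := by ring
      _ ≤ _ := by gcongr
  linarith

/-- A function `u` together with its first and second derivatives, solving the defocusing
quintic wave equation. -/
structure WaveJet (u ut utt : ℝ → E3 → ℝ) (us uts : Fin 3 → ℝ → E3 → ℝ)
    (uss : Fin 3 → Fin 3 → ℝ → E3 → ℝ) : Prop where
  cont : Continuous (uncurry u)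
  cont_t : Continuous (uncurry ut)
  cont_tt : Continuous (uncurry utt)
  cont_s : ∀ i, Continuous (uncurry (us i))
  cont_ts : ∀ i, Continuous (uncurry (uts i))
  cont_ss : ∀ i j, Continuous (uncurry (uss i j))
  deriv_t : ∀ t x, HasDerivAt (fun s => u s x) (ut t x) t
  deriv_tt : ∀ t x, HasDerivAt (fun s => ut s x) (utt t x) t
  deriv_st : ∀ i t x, HasDerivAt (fun s => us i s x) (uts i t x) t
  deriv_s : ∀ i t x, HasLineDerivAt ℝ (u t) (us i t x) x (bvec i)
  deriv_ts : ∀ i t x, HasLineDerivAt ℝ (ut t) (uts i t x) x (bvec i)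
  deriv_ss : ∀ i j t x, HasLineDerivAt ℝ (us j t) (uss i j t x) x (bvec i)
  symm : ∀ i j t x, uss i j t x = uss j i t x
  pde : ∀ t x, utt t x - ∑ i, uss i i t x + u t x ^ 5 = 0

/-- The energy density in terms of `u` and its first derivatives. -/
def jetEnergy (u ut : ℝ → E3 → ℝ) (us : Fin 3 → ℝ → E3 → ℝ) (t : ℝ) (x : E3) : ℝ :=
  (1 / 2) * ut t x ^ 2 + (1 / 2) * (∑ k, us k t x ^ 2) + (1 / 6) * u t x ^ 6

/-- The interaction Morawetz density with kernel `ψ (x - y)` and cutoff `χ y`, on pairs of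
points `p = (x, y)`. -/
def interDensity (ψ χ : E3 → ℝ) (u ut : ℝ → E3 → ℝ) (us : Fin 3 → ℝ → E3 → ℝ) (t : ℝ)
    (p : E3 × E3) : ℝ :=
  ψ (p.1 - p.2) * χ p.2 *
    (ut t p.1 * (∑ k, (p.1 k - p.2 k) * us k t p.1) + ut t p.1 * u t p.1) *
    jetEnergy u ut us t p.2

/-- The time derivative of `interDensity`. -/
def interDensityDeriv (ψ χ : E3 → ℝ) (u ut utt : ℝ → E3 → ℝ) (us uts : Fin 3 → ℝ → E3 → ℝ)
    (t : ℝ) (p : E3 × E3) : ℝ :=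
  ψ (p.1 - p.2) * χ p.2 *
      (utt t p.1 * (∑ k, (p.1 k - p.2 k) * us k t p.1) +
        ut t p.1 * (∑ k, (p.1 k - p.2 k) * uts k t p.1) +
        (utt t p.1 * u t p.1 + ut t p.1 * ut t p.1)) * jetEnergy u ut us t p.2 +
    ψ (p.1 - p.2) * χ p.2 *
      (ut t p.1 * (∑ k, (p.1 k - p.2 k) * us k t p.1) + ut t p.1 * u t p.1) *
      (ut t p.2 * utt t p.2 + (∑ k, us k t p.2 * uts k t p.2) + u t p.2 ^ 5 * ut t p.2)

/-- The flux of the interaction density in the `x` variable. -/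
def interFluxX (ψ χ : E3 → ℝ) (u ut : ℝ → E3 → ℝ) (us : Fin 3 → ℝ → E3 → ℝ) (t : ℝ) (i : Fin 3)
    (p : E3 × E3) : ℝ :=
  χ p.2 * jetEnergy u ut us t p.2 *
    (ψ (p.1 - p.2) * us i t p.1 * ((∑ k, (p.1 k - p.2 k) * us k t p.1) + u t p.1) +
      ψ (p.1 - p.2) * (p.1 i - p.2 i) *
        ((1 / 2) * ut t p.1 ^ 2 - (1 / 2) * (∑ k, us k t p.1 ^ 2) - (1 / 6) * u t p.1 ^ 6))

/-- The divergence of `interFluxX`, one coordinate at a time. -/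
def interFluxXDeriv (ψ χ : E3 → ℝ) (u ut : ℝ → E3 → ℝ) (us uts : Fin 3 → ℝ → E3 → ℝ)
    (uss : Fin 3 → Fin 3 → ℝ → E3 → ℝ) (t : ℝ) (i : Fin 3) (p : E3 × E3) : ℝ :=
  χ p.2 * jetEnergy u ut us t p.2 *
    ((fderiv ℝ ψ (p.1 - p.2) (bvec i) * us i t p.1 + ψ (p.1 - p.2) * uss i i t p.1) *
        ((∑ k, (p.1 k - p.2 k) * us k t p.1) + u t p.1) +
      ψ (p.1 - p.2) * us i t p.1 *
        ((us i t p.1 + ∑ k, (p.1 k - p.2 k) * uss i k t p.1) + us i t p.1) +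
      ((fderiv ℝ ψ (p.1 - p.2) (bvec i) * (p.1 i - p.2 i) + ψ (p.1 - p.2)) *
          ((1 / 2) * ut t p.1 ^ 2 - (1 / 2) * (∑ k, us k t p.1 ^ 2) - (1 / 6) * u t p.1 ^ 6) +
        ψ (p.1 - p.2) * (p.1 i - p.2 i) *
          (ut t p.1 * uts i t p.1 - (∑ k, us k t p.1 * uss i k t p.1) -
            u t p.1 ^ 5 * us i t p.1)))

/-- The flux of the interaction density in the `y` variable. -/
def interFluxY (ψ χ : E3 → ℝ) (u ut : ℝ → E3 → ℝ) (us : Fin 3 → ℝ → E3 → ℝ) (t : ℝ) (i : Fin 3)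
    (p : E3 × E3) : ℝ :=
  ψ (p.1 - p.2) * χ p.2 *
    (ut t p.1 * (∑ k, (p.1 k - p.2 k) * us k t p.1) + ut t p.1 * u t p.1) *
    (ut t p.2 * us i t p.2)

/-- The divergence of `interFluxY`, one coordinate at a time. -/
def interFluxYDeriv (ψ χ : E3 → ℝ) (u ut : ℝ → E3 → ℝ) (us uts : Fin 3 → ℝ → E3 → ℝ)
    (uss : Fin 3 → Fin 3 → ℝ → E3 → ℝ) (t : ℝ) (i : Fin 3) (p : E3 × E3) : ℝ :=
  (-fderiv ℝ ψ (p.1 - p.2) (bvec i) * χ p.2 + ψ (p.1 - p.2) * fderiv ℝ χ p.2 (bvec i)) *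
      (ut t p.1 * (∑ k, (p.1 k - p.2 k) * us k t p.1) + ut t p.1 * u t p.1) *
      (ut t p.2 * us i t p.2) +
    ψ (p.1 - p.2) * χ p.2 * (-(ut t p.1 * us i t p.1)) * (ut t p.2 * us i t p.2) +
    ψ (p.1 - p.2) * χ p.2 *
      (ut t p.1 * (∑ k, (p.1 k - p.2 k) * us k t p.1) + ut t p.1 * u t p.1) *
      (uts i t p.2 * us i t p.2 + ut t p.2 * uss i i t p.2)

theorem hasLineDerivAt_of_fst {F : E3 × E3 → ℝ} {F' : ℝ} {p : E3 × E3} {v : E3}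
    (h : HasLineDerivAt ℝ (fun x => F (x, p.2)) F' p.1 v) : HasLineDerivAt ℝ F F' p (v, 0) := by
  unfold HasLineDerivAt at *
  convert! h using 3
  ext <;> simp

theorem hasLineDerivAt_of_snd {F : E3 × E3 → ℝ} {F' : ℝ} {p : E3 × E3} {v : E3}
    (h : HasLineDerivAt ℝ (fun y => F (p.1, y)) F' p.2 v) : HasLineDerivAt ℝ F F' p (0, v) := by
  unfold HasLineDerivAt at *
  convert! h using 3
  ext <;> simp

theorem hasLineDerivAt_comp_sub_const {ψ : E3 → ℝ} (h : Differentiable ℝ ψ) (x y v : E3) :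
    HasLineDerivAt ℝ (fun x => ψ (x - y)) (fderiv ℝ ψ (x - y) v) x v := by
  have := ((h (x - y)).hasFDerivAt.comp x ((hasFDerivAt_id x).sub_const y)).hasLineDerivAt v
  convert! this using 1

theorem hasLineDerivAt_comp_const_sub {ψ : E3 → ℝ} (h : Differentiable ℝ ψ) (x y v : E3) :
    HasLineDerivAt ℝ (fun y => ψ (x - y)) (-fderiv ℝ ψ (x - y) v) y v := by
  have := ((h (x - y)).hasFDerivAt.comp y ((hasFDerivAt_id y).const_sub x)).hasLineDerivAt v
  convert! this using 1
  simp

theorem hasLineDerivAt_const_sub_coord (i j : Fin 3) (x y : E3) :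
    HasLineDerivAt ℝ (fun y : E3 => x i - y i) (-(if i = j then 1 else 0)) y (bvec j) := by
  have h := (hasLineDerivAt_coord i j y x).neg
  unfold HasLineDerivAt at *
  convert! h using 2
  simp

namespace WaveJet

variable {u ut utt : ℝ → E3 → ℝ} {us uts : Fin 3 → ℝ → E3 → ℝ}
  {uss : Fin 3 → Fin 3 → ℝ → E3 → ℝ} {ψ χ : E3 → ℝ}

theorem hasDerivAt_energy (h : WaveJet u ut utt us uts uss) (t : ℝ) (x : E3) :
    HasDerivAt (fun s => jetEnergy u ut us s x)
      (ut t x * utt t x + (∑ k, us k t x * uts k t x) + u t x ^ 5 * ut t x) t := by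
  unfold jetEnergy
  have h1 := ((h.deriv_tt t x).pow 2).const_mul (1 / 2)
  have h2 := (HasDerivAt.fun_sum (u := Finset.univ) fun k _ =>
    (h.deriv_st k t x).pow 2).const_mul (1 / 2)
  have h3 := ((h.deriv_t t x).pow 6).const_mul (1 / 6)
  convert! (h1.add h2).add h3 using 1
  simp only [Fin.sum_univ_three]
  push_cast
  ring

theorem hasDerivAt_interDensity (h : WaveJet u ut utt us uts uss) (t : ℝ) (p : E3 × E3) :
    HasDerivAt (fun s => interDensity ψ χ u ut us s p)
      (interDensityDeriv ψ χ u ut utt us uts t p) t := by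
  have h1 := HasDerivAt.fun_sum (u := Finset.univ) fun k _ =>
    (h.deriv_st k t p.1).const_mul (p.1 k - p.2 k)
  have h2 := (((h.deriv_tt t p.1).mul h1).add ((h.deriv_tt t p.1).mul (h.deriv_t t p.1))).const_mul
    (ψ (p.1 - p.2) * χ p.2)
  exact h2.mul (h.hasDerivAt_energy t p.2)

theorem hasLineDerivAt_interFluxX (h : WaveJet u ut utt us uts uss) (hψ : Differentiable ℝ ψ)
    (t : ℝ) (i : Fin 3) (p : E3 × E3) :
    HasLineDerivAt ℝ (interFluxX ψ χ u ut us t i)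
      (interFluxXDeriv ψ χ u ut us uts uss t i p) p (bvec i, 0) := by
  apply hasLineDerivAt_of_fst
  have hp := hasLineDerivAt_comp_sub_const hψ p.1 p.2 (bvec i)
  have hz := fun k => hasLineDerivAt_coord k i p.1 p.2
  have h0 := h.deriv_s i t p.1
  have h1 := h.deriv_ts i t p.1
  have h2 := fun k => h.deriv_ss i k t p.1
  unfold HasLineDerivAt at *
  have hsum := HasDerivAt.fun_sum (u := Finset.univ) fun k _ => (hz k).mul (h2 k)
  have hsq := HasDerivAt.fun_sum (u := Finset.univ) fun k _ => (h2 k).pow 2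
  have hlag := (((h1.pow 2).const_mul (1 / 2)).sub (hsq.const_mul (1 / 2))).sub
    ((h0.pow 6).const_mul (1 / 6))
  have key := (((hp.mul (h2 i)).mul (hsum.add h0)).add ((hp.mul (hz i)).mul hlag)).const_mul
    (χ p.2 * jetEnergy u ut us t p.2)
  refine key.congr_deriv ?_
  simp only [zero_smul, add_zero, interFluxXDeriv]
  fin_cases i <;> simp [Fin.sum_univ_three, -mul_eq_mul_left_iff, -mul_eq_mul_right_iff] <;> ring

theorem hasLineDerivAt_interFluxY (h : WaveJet u ut utt us uts uss) (hψ : Differentiable ℝ ψ)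
    (hχ : Differentiable ℝ χ) (t : ℝ) (i : Fin 3) (p : E3 × E3) :
    HasLineDerivAt ℝ (interFluxY ψ χ u ut us t i)
      (interFluxYDeriv ψ χ u ut us uts uss t i p) p (0, bvec i) := by
  apply hasLineDerivAt_of_snd
  have hp := hasLineDerivAt_comp_const_sub hψ p.1 p.2 (bvec i)
  have hx := (hχ p.2).hasFDerivAt.hasLineDerivAt (bvec i)
  have hz := fun k => hasLineDerivAt_const_sub_coord k i p.1 p.2
  have h1 := h.deriv_ts i t p.2
  have h2 := h.deriv_ss i i t p.2
  unfold HasLineDerivAt at *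
  have hsum := HasDerivAt.fun_sum (u := Finset.univ) fun k _ =>
    (hz k).mul_const (us k t p.1)
  have key := ((hp.mul hx).mul ((hsum.const_mul (ut t p.1)).add_const (ut t p.1 * u t p.1))).mul
    (h1.mul h2)
  refine key.congr_deriv ?_
  simp only [zero_smul, add_zero, interFluxYDeriv]
  fin_cases i <;> simp [Fin.sum_univ_three] <;> ring

theorem continuous_energy (h : WaveJet u ut utt us uts uss) :
    Continuous (uncurry (jetEnergy u ut us)) := by
  have c0 := h.cont
  have c1 := h.cont_t
  have c2 := h.cont_s
  unfold jetEnergy uncurry at *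
  fun_prop

end WaveJet

/-- The density controlled by the interaction Morawetz estimate, in the `x` variable. -/
def jetLower (u ut : ℝ → E3 → ℝ) (us : Fin 3 → ℝ → E3 → ℝ) (t : ℝ) (x : E3) : ℝ :=
  (1 / 2) * (|ut t x| - √(∑ k, us k t x ^ 2)) ^ 2 + (1 / 6) * u t x ^ 6

/-- The density controlled by the interaction Morawetz estimate, in the `y` variable. -/
def jetUpper (u ut : ℝ → E3 → ℝ) (us : Fin 3 → ℝ → E3 → ℝ) (t : ℝ) (x : E3) : ℝ :=
  (1 / 2) * ut t x ^ 2 + (1 / 2) * (∑ k, us k t x ^ 2) + (2 / 3) * u t x ^ 6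

/-- The integrand of the interaction Morawetz estimate. -/
def interTarget (ψ χ : E3 → ℝ) (u ut : ℝ → E3 → ℝ) (us : Fin 3 → ℝ → E3 → ℝ) (t : ℝ)
    (p : E3 × E3) : ℝ :=
  ψ (p.1 - p.2) * χ p.2 * (jetLower u ut us t p.1 * jetUpper u ut us t p.2)

/-- The majorant of the interaction density: energy in `y` against energy and Hardy density
in `x`. -/
def interMajorant (ρ : ℝ) (u ut : ℝ → E3 → ℝ) (us : Fin 3 → ℝ → E3 → ℝ) (t : ℝ)
    (p : E3 × E3) : ℝ :=
  jetEnergy u ut us t p.2 * (jetEnergy u ut us t p.1 + u t p.1 ^ 2 * hardyWeight ρ p.2 p.1)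

/-- Admissible pairs of an interaction kernel `ψ` and a cutoff `χ`. -/
structure InterKernel (ψ χ : E3 → ℝ) (ρ A T : ℝ) : Prop where
  smooth : ContDiff ℝ 1 ψ
  smooth_cutoff : ContDiff ℝ 1 χ
  compact : HasCompactSupport ψ
  compact_cutoff : HasCompactSupport χ
  nonneg : ∀ z, 0 ≤ ψ z
  cutoff_nonneg : ∀ y, 0 ≤ χ y
  cutoff_le : ∀ y, χ y ≤ 1
  radius_pos : 0 < ρ
  time_pos : 0 < T
  kernel_le : ∀ z, ψ z * (‖z‖ + ρ) ≤ A * T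
  deriv_le : ∀ z, ‖fderiv ℝ ψ z‖ * (‖z‖ + ρ) ≤ A
  deriv_cutoff_le : ∀ y, T * ‖fderiv ℝ χ y‖ ≤ 1

instance isAddHaarMeasure_prod_volume : (volume : Measure (E3 × E3)).IsAddHaarMeasure :=
  inferInstanceAs ((volume : Measure E3).prod (volume : Measure E3)).IsAddHaarMeasure

/-- A compact set of pairs `(x, y)` outside of which `ψ (x - y) χ y` and its derivatives
vanish. -/
def interSupport (ψ χ : E3 → ℝ) : Set (E3 × E3) :=
  (fun q : E3 × E3 => (q.1 + q.2, q.2)) '' (tsupport ψ ×ˢ tsupport χ)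

theorem isCompact_interSupport {ψ χ : E3 → ℝ} (hψ : HasCompactSupport ψ)
    (hχ : HasCompactSupport χ) : IsCompact (interSupport ψ χ) :=
  (hψ.isCompact.prod hχ.isCompact).image (by fun_prop)

theorem eq_zero_of_notMem_interSupport {ψ χ : E3 → ℝ} {p : E3 × E3}
    (hp : p ∉ interSupport ψ χ) :
    (ψ (p.1 - p.2) = 0 ∧ fderiv ℝ ψ (p.1 - p.2) = 0) ∨ (χ p.2 = 0 ∧ fderiv ℝ χ p.2 = 0) := by
  by_cases h : p.1 - p.2 ∈ tsupport ψ
  · right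
    have h' : p.2 ∉ tsupport χ := fun h' => hp ⟨(p.1 - p.2, p.2), ⟨h, h'⟩, by simp⟩
    exact ⟨image_eq_zero_of_notMem_tsupport h', fderiv_of_notMem_tsupport ℝ h'⟩
  · left
    exact ⟨image_eq_zero_of_notMem_tsupport h, fderiv_of_notMem_tsupport ℝ h⟩

theorem continuous_integral_of_compact {V : Type*} [TopologicalSpace V] [MeasurableSpace V]
    [OpensMeasurableSpace V] {μ : Measure V} [IsLocallyFiniteMeasure μ] {D : ℝ → V → ℝ}
    {K : Set V} (hK : IsCompact K) (hD : Continuous (uncurry D)) (h0 : ∀ t, ∀ p ∉ K, D t p = 0) :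
    Continuous fun t => ∫ p, D t p ∂μ := by
  have h := continuous_parametric_integral_of_continuous (μ := μ) hD hK
  simpa only [fun t => setIntegral_eq_integral_of_forall_compl_eq_zero (μ := μ) (h0 t)] using h

theorem integrable_of_compact {D : E3 × E3 → ℝ} {K : Set (E3 × E3)} (hK : IsCompact K)
    (hD : Continuous D) (h0 : ∀ p ∉ K, D p = 0) : Integrable D :=
  hD.integrable_of_hasCompactSupport (HasCompactSupport.intro hK h0)

theorem interDensity_eq_zero {ψ χ : E3 → ℝ} {u ut : ℝ → E3 → ℝ} {us : Fin 3 → ℝ → E3 → ℝ} {t : ℝ}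
    {p : E3 × E3} (hp : p ∉ interSupport ψ χ) : interDensity ψ χ u ut us t p = 0 := by
  rcases eq_zero_of_notMem_interSupport hp with h | h <;> simp [interDensity, h]

theorem interTarget_eq_zero {ψ χ : E3 → ℝ} {u ut : ℝ → E3 → ℝ} {us : Fin 3 → ℝ → E3 → ℝ} {t : ℝ}
    {p : E3 × E3} (hp : p ∉ interSupport ψ χ) : interTarget ψ χ u ut us t p = 0 := by
  rcases eq_zero_of_notMem_interSupport hp with h | h <;> simp [interTarget, h]

theorem interDensityDeriv_eq_zero {ψ χ : E3 → ℝ} {u ut utt : ℝ → E3 → ℝ}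
    {us uts : Fin 3 → ℝ → E3 → ℝ} {t : ℝ} {p : E3 × E3} (hp : p ∉ interSupport ψ χ) :
    interDensityDeriv ψ χ u ut utt us uts t p = 0 := by
  rcases eq_zero_of_notMem_interSupport hp with h | h <;> simp [interDensityDeriv, h]

theorem interFluxX_eq_zero {ψ χ : E3 → ℝ} {u ut : ℝ → E3 → ℝ} {us : Fin 3 → ℝ → E3 → ℝ} {t : ℝ}
    {i : Fin 3} {p : E3 × E3} (hp : p ∉ interSupport ψ χ) : interFluxX ψ χ u ut us t i p = 0 := by
  rcases eq_zero_of_notMem_interSupport hp with h | h <;> simp [interFluxX, h]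

theorem interFluxY_eq_zero {ψ χ : E3 → ℝ} {u ut : ℝ → E3 → ℝ} {us : Fin 3 → ℝ → E3 → ℝ} {t : ℝ}
    {i : Fin 3} {p : E3 × E3} (hp : p ∉ interSupport ψ χ) : interFluxY ψ χ u ut us t i p = 0 := by
  rcases eq_zero_of_notMem_interSupport hp with h | h <;> simp [interFluxY, h]

theorem interFluxXDeriv_eq_zero {ψ χ : E3 → ℝ} {u ut : ℝ → E3 → ℝ} {us uts : Fin 3 → ℝ → E3 → ℝ}
    {uss : Fin 3 → Fin 3 → ℝ → E3 → ℝ} {t : ℝ} {i : Fin 3} {p : E3 × E3}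
    (hp : p ∉ interSupport ψ χ) : interFluxXDeriv ψ χ u ut us uts uss t i p = 0 := by
  rcases eq_zero_of_notMem_interSupport hp with h | h <;> simp [interFluxXDeriv, h]

theorem interFluxYDeriv_eq_zero {ψ χ : E3 → ℝ} {u ut : ℝ → E3 → ℝ} {us uts : Fin 3 → ℝ → E3 → ℝ}
    {uss : Fin 3 → Fin 3 → ℝ → E3 → ℝ} {t : ℝ} {i : Fin 3} {p : E3 × E3}
    (hp : p ∉ interSupport ψ χ) : interFluxYDeriv ψ χ u ut us uts uss t i p = 0 := by
  rcases eq_zero_of_notMem_interSupport hp with h | h <;> simp [interFluxYDeriv, h]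

theorem jetEnergy_nonneg (u ut : ℝ → E3 → ℝ) (us : Fin 3 → ℝ → E3 → ℝ) (t : ℝ) (x : E3) :
    0 ≤ jetEnergy u ut us t x := by
  unfold jetEnergy
  have := Finset.sum_nonneg fun k (_ : k ∈ Finset.univ) => sq_nonneg (us k t x)
  positivity

theorem jetLower_nonneg (u ut : ℝ → E3 → ℝ) (us : Fin 3 → ℝ → E3 → ℝ) (t : ℝ) (x : E3) :
    0 ≤ jetLower u ut us t x := by
  unfold jetLower
  positivity

theorem jetLower_le (u ut : ℝ → E3 → ℝ) (us : Fin 3 → ℝ → E3 → ℝ) (t : ℝ) (x : E3) :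
    jetLower u ut us t x ≤ jetEnergy u ut us t x := by
  unfold jetLower jetEnergy
  have h := Real.sq_sqrt (Finset.sum_nonneg fun k (_ : k ∈ Finset.univ) => sq_nonneg (us k t x))
  have h' := mul_nonneg (abs_nonneg (ut t x)) (Real.sqrt_nonneg (∑ k, us k t x ^ 2))
  linarith [sq_abs (ut t x)]

theorem jetUpper_nonneg (u ut : ℝ → E3 → ℝ) (us : Fin 3 → ℝ → E3 → ℝ) (t : ℝ) (x : E3) :
    0 ≤ jetUpper u ut us t x := by
  unfold jetUpper
  have := Finset.sum_nonneg fun k (_ : k ∈ Finset.univ) => sq_nonneg (us k t x)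
  positivity

theorem jetUpper_le (u ut : ℝ → E3 → ℝ) (us : Fin 3 → ℝ → E3 → ℝ) (t : ℝ) (x : E3) :
    jetUpper u ut us t x ≤ 4 * jetEnergy u ut us t x := by
  unfold jetUpper jetEnergy
  have := Finset.sum_nonneg fun k (_ : k ∈ Finset.univ) => sq_nonneg (us k t x)
  linarith [sq_nonneg (ut t x)]

namespace WaveJet

variable {u ut utt : ℝ → E3 → ℝ} {us uts : Fin 3 → ℝ → E3 → ℝ}
  {uss : Fin 3 → Fin 3 → ℝ → E3 → ℝ} {ψ χ : E3 → ℝ}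

theorem continuous_lower (h : WaveJet u ut utt us uts uss) :
    Continuous (uncurry (jetLower u ut us)) := by
  have c0 := h.cont
  have c1 := h.cont_t
  have c2 := h.cont_s
  unfold jetLower uncurry at *
  fun_prop

theorem continuous_upper (h : WaveJet u ut utt us uts uss) :
    Continuous (uncurry (jetUpper u ut us)) := by
  have c0 := h.cont
  have c1 := h.cont_t
  have c2 := h.cont_s
  unfold jetUpper uncurry at *
  fun_prop

theorem continuous_interTarget (h : WaveJet u ut utt us uts uss) (hψ : Continuous ψ)
    (hχ : Continuous χ) : Continuous (uncurry (interTarget ψ χ u ut us)) := by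
  have c1 := h.continuous_lower
  have c2 := h.continuous_upper
  unfold interTarget uncurry at *
  fun_prop

theorem continuous_interDensity (h : WaveJet u ut utt us uts uss) (hψ : Continuous ψ)
    (hχ : Continuous χ) : Continuous (uncurry (interDensity ψ χ u ut us)) := by
  have c0 := h.cont
  have c1 := h.cont_t
  have c2 := h.cont_s
  have c3 := h.continuous_energy
  unfold interDensity uncurry at *
  fun_prop

theorem continuous_interDensityDeriv (h : WaveJet u ut utt us uts uss) (hψ : Continuous ψ)
    (hχ : Continuous χ) : Continuous (uncurry (interDensityDeriv ψ χ u ut utt us uts)) := by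
  have c0 := h.cont
  have c1 := h.cont_t
  have c2 := h.cont_s
  have c3 := h.continuous_energy
  have c4 := h.cont_tt
  have c5 := h.cont_ts
  unfold interDensityDeriv uncurry at *
  fun_prop

theorem continuous_interFluxX (h : WaveJet u ut utt us uts uss) (hψ : Continuous ψ)
    (hχ : Continuous χ) (t : ℝ) (i : Fin 3) : Continuous (interFluxX ψ χ u ut us t i) := by
  have c0 := h.cont
  have c1 := h.cont_t
  have c2 := h.cont_s
  have c3 := h.continuous_energy
  unfold interFluxX uncurry at *
  fun_prop

theorem continuous_interFluxY (h : WaveJet u ut utt us uts uss) (hψ : Continuous ψ)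
    (hχ : Continuous χ) (t : ℝ) (i : Fin 3) : Continuous (interFluxY ψ χ u ut us t i) := by
  have c0 := h.cont
  have c1 := h.cont_t
  have c2 := h.cont_s
  unfold interFluxY uncurry at *
  fun_prop

theorem continuous_interFluxXDeriv (h : WaveJet u ut utt us uts uss) (hψ : ContDiff ℝ 1 ψ)
    (hχ : Continuous χ) (t : ℝ) (i : Fin 3) :
    Continuous (interFluxXDeriv ψ χ u ut us uts uss t i) := by
  have c0 := h.cont
  have c1 := h.cont_t
  have c2 := h.cont_s
  have c3 := h.continuous_energy
  have c4 := h.cont_ts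
  have c5 := h.cont_ss
  have c6 := hψ.continuous
  have c7 := hψ.continuous_fderiv one_ne_zero
  unfold interFluxXDeriv uncurry at *
  fun_prop

theorem continuous_interFluxYDeriv (h : WaveJet u ut utt us uts uss) (hψ : ContDiff ℝ 1 ψ)
    (hχ : ContDiff ℝ 1 χ) (t : ℝ) (i : Fin 3) :
    Continuous (interFluxYDeriv ψ χ u ut us uts uss t i) := by
  have c0 := h.cont
  have c1 := h.cont_t
  have c2 := h.cont_s
  have c4 := h.cont_ts
  have c5 := h.cont_ss
  have c6 := hψ.continuous
  have c7 := hψ.continuous_fderiv one_ne_zero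
  have c8 := hχ.continuous
  have c9 := hχ.continuous_fderiv one_ne_zero
  unfold interFluxYDeriv uncurry at *
  fun_prop

theorem integral_interFluxXDeriv (h : WaveJet u ut utt us uts uss) {ρ A T : ℝ}
    (hk : InterKernel ψ χ ρ A T) (t : ℝ) (i : Fin 3) :
    ∫ p, interFluxXDeriv ψ χ u ut us uts uss t i p = 0 := by
  have hK := isCompact_interSupport hk.compact hk.compact_cutoff
  exact integral_lineDeriv_eq_zero
    (integrable_of_compact hK
      (h.continuous_interFluxX hk.smooth.continuous hk.smooth_cutoff.continuous t i)
      fun p hp => interFluxX_eq_zero hp)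
    (integrable_of_compact hK
      (h.continuous_interFluxXDeriv hk.smooth hk.smooth_cutoff.continuous t i)
      fun p hp => interFluxXDeriv_eq_zero hp)
    (h.hasLineDerivAt_interFluxX (hk.smooth.differentiable one_ne_zero) t i)

theorem integral_interFluxYDeriv (h : WaveJet u ut utt us uts uss) {ρ A T : ℝ}
    (hk : InterKernel ψ χ ρ A T) (t : ℝ) (i : Fin 3) :
    ∫ p, interFluxYDeriv ψ χ u ut us uts uss t i p = 0 := by
  have hK := isCompact_interSupport hk.compact hk.compact_cutoff
  exact integral_lineDeriv_eq_zero
    (integrable_of_compact hK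
      (h.continuous_interFluxY hk.smooth.continuous hk.smooth_cutoff.continuous t i)
      fun p hp => interFluxY_eq_zero hp)
    (integrable_of_compact hK
      (h.continuous_interFluxYDeriv hk.smooth hk.smooth_cutoff t i)
      fun p hp => interFluxYDeriv_eq_zero hp)
    (h.hasLineDerivAt_interFluxY (hk.smooth.differentiable one_ne_zero)
      (hk.smooth_cutoff.differentiable one_ne_zero) t i)

end WaveJet

theorem sqrt_sum_fderiv_sq (f : E3 → ℝ) (x : E3) :
    √(∑ i, fderiv ℝ f x (bvec i) ^ 2) = ‖fderiv ℝ f x‖ := by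
  rw [← _root_.norm_gradient_sq, Real.sqrt_sq (norm_nonneg _), norm_gradient]

theorem sqrt_sum_coord_sq (x y : E3) : √(∑ i, (x i - y i) ^ 2) = ‖x - y‖ := by
  rw [EuclideanSpace.norm_eq]
  simp

theorem abs_le_hardy {ρ : ℝ} (hρ : 0 < ρ) (v : ℝ) (x y : E3) :
    |v| ≤ √(v ^ 2 * hardyWeight ρ y x) * (‖x - y‖ + ρ) := by
  have hw := hardyWeight_pos hρ y x
  rw [Real.sqrt_mul (sq_nonneg v), Real.sqrt_sq_eq_abs, mul_assoc]
  refine le_mul_of_one_le_right (abs_nonneg v) ?_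
  rw [← Real.sqrt_sq (by positivity : 0 ≤ ‖x - y‖ + ρ), ← Real.sqrt_mul hw.le, Real.one_le_sqrt,
    hardyWeight, inv_mul_eq_div, one_le_div (by positivity)]
  nlinarith [norm_nonneg (x - y)]

namespace WaveJet

variable {u ut utt : ℝ → E3 → ℝ} {us uts : Fin 3 → ℝ → E3 → ℝ}
  {uss : Fin 3 → Fin 3 → ℝ → E3 → ℝ} {ψ χ : E3 → ℝ} {ρ A T E : ℝ}

theorem interDensityDeriv_sub_flux_le (h : WaveJet u ut utt us uts uss)
    (hk : InterKernel ψ χ ρ A T) (t : ℝ) (p : E3 × E3) :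
    interDensityDeriv ψ χ u ut utt us uts t p - ∑ i, interFluxXDeriv ψ χ u ut us uts uss t i p -
        ∑ i, interFluxYDeriv ψ χ u ut us uts uss t i p ≤
      -(1 / 4) * interTarget ψ χ u ut us t p + 8 * A * interMajorant ρ u ut us t p := by
  obtain ⟨x, y⟩ := p
  have key := morawetz_identity (ψ (x - y)) (χ y) (u t x) (ut t x) (utt t x) (u t y) (ut t y)
    (utt t y) (fun i => fderiv ℝ ψ (x - y) (bvec i)) (fun i => fderiv ℝ χ y (bvec i))
    (fun k => x k - y k) (fun k => us k t x) (fun k => uts k t x) (fun k => us k t y)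
    (fun k => uts k t y) (fun i j => uss i j t x) (fun i j => uss i j t y)
    (fun i j => h.symm i j t x) (h.pde t x) (h.pde t y)
  have hS := fun z => Finset.sum_nonneg fun k (_ : k ∈ Finset.univ) => sq_nonneg (us k t z)
  have hw := hardyWeight_pos hk.radius_pos y x
  have bound := morawetz_pointwise (ψ := ψ (x - y)) (χ := χ y) (u := u t x) (ut := ut t x)
    (u' := u t y) (ut' := ut t y) (g := √(∑ k, us k t x ^ 2)) (g' := √(∑ k, us k t y ^ 2))
    (a := ∑ k, fderiv ℝ ψ (x - y) (bvec k) * us k t x)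
    (a' := ∑ k, us k t y * fderiv ℝ ψ (x - y) (bvec k))
    (b := ∑ k, (x k - y k) * us k t x)
    (c := ∑ k, (x k - y k) * fderiv ℝ ψ (x - y) (bvec k))
    (c' := ∑ k, us k t y * fderiv ℝ χ y (bvec k))
    (d := ∑ k, us k t x * us k t y) (r := ‖x - y‖) (q := ‖fderiv ℝ ψ (x - y)‖)
    (s := ‖fderiv ℝ χ y‖) (ρ := ρ) (k := √(u t x ^ 2 * hardyWeight ρ y x)) (A := A) (T := T)
    (hk.nonneg _) (hk.cutoff_nonneg _) (hk.cutoff_le _) (Real.sqrt_nonneg _) (Real.sqrt_nonneg _)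
    (norm_nonneg _) (norm_nonneg _) (norm_nonneg _) hk.radius_pos.le (Real.sqrt_nonneg _)
    (by rw [← sqrt_sum_fderiv_sq]; exact abs_sum_mul_le _ _)
    (by rw [← sqrt_sum_fderiv_sq]; exact abs_sum_mul_le _ _)
    (by rw [← sqrt_sum_coord_sq]; exact abs_sum_mul_le _ _)
    (by rw [← sqrt_sum_coord_sq, ← sqrt_sum_fderiv_sq]; exact abs_sum_mul_le _ _)
    (by rw [← sqrt_sum_fderiv_sq]; exact abs_sum_mul_le _ _)
    (abs_sum_mul_le _ _) (abs_le_hardy hk.radius_pos _ _ _)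
    (hk.deriv_le _) (hk.kernel_le _) (hk.deriv_cutoff_le _)
  have hF : jetLower u ut us t x =
    (1 / 2) * (|ut t x| - √(∑ k, us k t x ^ 2)) ^ 2 + (1 / 6) * u t x ^ 6 := rfl
  rw [← hF, Real.sq_sqrt (hS x), Real.sq_sqrt (hS y),
    Real.sq_sqrt (by positivity : 0 ≤ u t x ^ 2 * hardyWeight ρ y x)] at bound
  refine le_trans (le_of_eq ?_) (bound.trans (le_of_eq ?_))
  · refine Eq.trans ?_ key
    rfl
  · rfl

theorem abs_interDensity_le (hk : InterKernel ψ χ ρ A T) (t : ℝ) (p : E3 × E3) :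
    |interDensity ψ χ u ut us t p| ≤ 2 * (A * T) * interMajorant ρ u ut us t p := by
  obtain ⟨x, y⟩ := p
  have hS := Finset.sum_nonneg fun k (_ : k ∈ Finset.univ) => sq_nonneg (us k t x)
  have hw := hardyWeight_pos hk.radius_pos y x
  have bound := morawetz_density_le (ψ := ψ (x - y)) (u := u t x) (ut := ut t x)
    (g := √(∑ k, us k t x ^ 2)) (b := ∑ k, (x k - y k) * us k t x) (r := ‖x - y‖) (ρ := ρ)
    (k := √(u t x ^ 2 * hardyWeight ρ y x)) (AT := A * T) (hk.nonneg _) (Real.sqrt_nonneg _)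
    hk.radius_pos.le (Real.sqrt_nonneg _)
    (by rw [← sqrt_sum_coord_sq]; exact abs_sum_mul_le _ _)
    (abs_le_hardy hk.radius_pos _ _ _) (hk.kernel_le _) (norm_nonneg _)
  rw [Real.sq_sqrt hS, Real.sq_sqrt (by positivity : 0 ≤ u t x ^ 2 * hardyWeight ρ y x)] at bound
  have he := jetEnergy_nonneg u ut us t y
  have hψ := hk.nonneg (x - y)
  have hχ := hk.cutoff_nonneg y
  simp only [interDensity, interMajorant]
  rw [abs_mul, abs_mul, abs_of_nonneg he, abs_of_nonneg (mul_nonneg hψ hχ)]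
  calc _ ≤ ψ (x - y) * 1 * |ut t x * ∑ k, (x k - y k) * us k t x + ut t x * u t x| *
        jetEnergy u ut us t y := by gcongr; exact hk.cutoff_le y
    _ ≤ 2 * (A * T) * ((1 / 2) * ut t x ^ 2 + (1 / 2) * (∑ k, us k t x ^ 2) + (1 / 6) * u t x ^ 6 +
        u t x ^ 2 * hardyWeight ρ y x) * jetEnergy u ut us t y := by
      rw [mul_one]
      gcongr
    _ = _ := by unfold jetEnergy; ring

end WaveJet

/-- Finite energy bounds at each time, with Hardy's inequality about every point. -/
structure EnergyBound (u ut : ℝ → E3 → ℝ) (us : Fin 3 → ℝ → E3 → ℝ) (ρ E : ℝ) : Prop where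
  integrable : ∀ t, Integrable (jetEnergy u ut us t)
  integrable_sq : ∀ t, Integrable fun x => u t x ^ 2
  energy_le : ∀ t, ∫ x, jetEnergy u ut us t x ≤ E
  hardy_le : ∀ t y, ∫ x, u t x ^ 2 * hardyWeight ρ y x ≤ 8 * E

namespace WaveJet

variable {u ut utt : ℝ → E3 → ℝ} {us uts : Fin 3 → ℝ → E3 → ℝ}
  {uss : Fin 3 → Fin 3 → ℝ → E3 → ℝ} {ψ χ : E3 → ℝ} {ρ A T E : ℝ}

theorem integrable_interMajorant (h : WaveJet u ut utt us uts uss) (hρ : 0 < ρ)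
    (hE : EnergyBound u ut us ρ E) (t : ℝ) : Integrable (interMajorant ρ u ut us t) := by
  have c0 := h.cont
  have c1 := h.continuous_energy
  have c2 := continuous_hardyWeight hρ
  have hc : Continuous (interMajorant ρ u ut us t) := by
    unfold interMajorant uncurry at *
    fun_prop
  have hdom : Integrable fun p : E3 × E3 =>
      (jetEnergy u ut us t p.1 + u t p.1 ^ 2 * (ρ ^ 2)⁻¹) * jetEnergy u ut us t p.2 :=
    ((hE.integrable t).add ((hE.integrable_sq t).mul_const _)).mul_prod (hE.integrable t)
  refine hdom.mono' hc.aestronglyMeasurable (Filter.Eventually.of_forall fun p => ?_)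
  have e1 := jetEnergy_nonneg u ut us t p.1
  have e2 := jetEnergy_nonneg u ut us t p.2
  have hw := hardyWeight_pos hρ p.2 p.1
  have hw' := hardyWeight_le hρ p.2 p.1
  unfold interMajorant
  rw [Real.norm_of_nonneg (by positivity), mul_comm]
  gcongr

theorem integral_interMajorant_le (h : WaveJet u ut utt us uts uss) (hρ : 0 < ρ)
    (hE : EnergyBound u ut us ρ E) (t : ℝ) : ∫ p, interMajorant ρ u ut us t p ≤ 9 * E ^ 2 := by
  have hE0 : 0 ≤ E :=
    (integral_nonneg fun x => jetEnergy_nonneg u ut us t x).trans (hE.energy_le t)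
  have hw : ∀ y, Integrable fun x => u t x ^ 2 * hardyWeight ρ y x := fun y =>
    (hE.integrable_sq t).mul_bdd (c := (ρ ^ 2)⁻¹)
      ((continuous_hardyWeight hρ).comp
        (f := fun x => (x, y)) (by fun_prop)).aestronglyMeasurable
      (Filter.Eventually.of_forall fun x => by
        rw [Real.norm_of_nonneg (hardyWeight_pos hρ y x).le]
        exact hardyWeight_le hρ y x)
  have hint := h.integrable_interMajorant hρ hE t
  rw [Measure.volume_eq_prod] at hint ⊢
  rw [integral_prod_symm _ hint]
  calc ∫ y, ∫ x, interMajorant ρ u ut us t (x, y)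
      ≤ ∫ y, jetEnergy u ut us t y * (9 * E) := by
        refine integral_mono hint.integral_prod_right ((hE.integrable t).mul_const _) fun y => ?_
        simp only [interMajorant]
        rw [integral_const_mul, integral_add (hE.integrable t) (hw y)]
        refine mul_le_mul_of_nonneg_left ?_ (jetEnergy_nonneg _ _ _ _ _)
        linarith [hE.energy_le t, hE.hardy_le t y]
    _ = (∫ y, jetEnergy u ut us t y) * (9 * E) := integral_mul_const _ _
    _ ≤ E * (9 * E) := by gcongr; exact hE.energy_le t
    _ = 9 * E ^ 2 := by ring

theorem continuous_integral_interTarget (h : WaveJet u ut utt us uts uss)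
    (hk : InterKernel ψ χ ρ A T) : Continuous fun t => ∫ p, interTarget ψ χ u ut us t p :=
  continuous_integral_of_compact (isCompact_interSupport hk.compact hk.compact_cutoff)
    (h.continuous_interTarget hk.smooth.continuous hk.smooth_cutoff.continuous)
    fun _ _ hp => interTarget_eq_zero hp

/-- The interaction Morawetz estimate with a cutoff. -/
theorem interaction_morawetz (h : WaveJet u ut utt us uts uss) (hk : InterKernel ψ χ ρ A T)
    (hE : EnergyBound u ut us ρ E) (a : ℝ) :
    ∫ t in a..(a + T), ∫ p, interTarget ψ χ u ut us t p ≤ 432 * A * T * E ^ 2 := by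
  have hK := isCompact_interSupport hk.compact hk.compact_cutoff
  have hT := hk.time_pos
  have hA : 0 ≤ A := le_trans
    (mul_nonneg (norm_nonneg _) (add_nonneg (norm_nonneg _) hk.radius_pos.le)) (hk.deriv_le 0)
  have cD := h.continuous_interDensity hk.smooth.continuous hk.smooth_cutoff.continuous
  have cD' := h.continuous_interDensityDeriv hk.smooth.continuous hk.smooth_cutoff.continuous
  have cT := h.continuous_interTarget hk.smooth.continuous hk.smooth_cutoff.continuous
  have slice : ∀ {D : ℝ → E3 × E3 → ℝ}, Continuous (uncurry D) → ∀ t, Continuous (D t) :=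
    fun hD t => hD.comp (f := fun p => (t, p)) (by fun_prop)
  set M := fun t => ∫ p, interDensity ψ χ u ut us t p with hM
  set M' := fun t => ∫ p, interDensityDeriv ψ χ u ut utt us uts t p with hM'
  have hderiv : ∀ t, HasDerivAt M (M' t) t := hasDerivAt_integral_of_compact hK
    (slice cD) cD' (fun _ _ hp => interDensity_eq_zero hp)
    (fun _ _ hp => interDensityDeriv_eq_zero hp) h.hasDerivAt_interDensity
  have cM' : Continuous M' :=
    continuous_integral_of_compact hK cD' fun _ _ hp => interDensityDeriv_eq_zero hp
  have cTar := h.continuous_integral_interTarget hk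
  have hMle : ∀ t, |M t| ≤ 2 * (A * T) * (9 * E ^ 2) := fun t => by
    calc |M t| = ‖∫ p, interDensity ψ χ u ut us t p‖ := rfl
      _ ≤ ∫ p, 2 * (A * T) * interMajorant ρ u ut us t p :=
          norm_integral_le_of_norm_le ((h.integrable_interMajorant hk.radius_pos hE t).const_mul _)
            (Filter.Eventually.of_forall fun p => abs_interDensity_le hk t p)
      _ = 2 * (A * T) * ∫ p, interMajorant ρ u ut us t p := integral_const_mul _ _
      _ ≤ _ := by
        gcongr
        exact h.integral_interMajorant_le hk.radius_pos hE t
  have hM'le : ∀ t, M' t ≤ -(1 / 4) * (∫ p, interTarget ψ χ u ut us t p) + 72 * A * E ^ 2 := by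
    intro t
    have iD' := integrable_of_compact hK (slice cD' t) fun p hp => interDensityDeriv_eq_zero hp
    have iX := fun i => integrable_of_compact hK
      (h.continuous_interFluxXDeriv hk.smooth hk.smooth_cutoff.continuous t i)
      fun p hp => interFluxXDeriv_eq_zero hp
    have iY := fun i => integrable_of_compact hK
      (h.continuous_interFluxYDeriv hk.smooth hk.smooth_cutoff t i)
      fun p hp => interFluxYDeriv_eq_zero hp
    have iT := integrable_of_compact hK (slice cT t) fun p hp => interTarget_eq_zero hp
    have iH := h.integrable_interMajorant hk.radius_pos hE t
    have iXs := integrable_finsetSum Finset.univ fun i _ => iX i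
    have iYs := integrable_finsetSum Finset.univ fun i _ => iY i
    have e : M' t = ∫ p, (interDensityDeriv ψ χ u ut utt us uts t p -
        ∑ i, interFluxXDeriv ψ χ u ut us uts uss t i p -
        ∑ i, interFluxYDeriv ψ χ u ut us uts uss t i p) := by
      have iDX : Integrable fun p => interDensityDeriv ψ χ u ut utt us uts t p -
        ∑ i, interFluxXDeriv ψ χ u ut us uts uss t i p := iD'.sub iXs
      rw [integral_sub iDX iYs, integral_sub iD' iXs,
        integral_finsetSum _ fun i _ => iX i, integral_finsetSum _ fun i _ => iY i]
      simp [h.integral_interFluxXDeriv hk, h.integral_interFluxYDeriv hk, hM']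
    rw [e]
    calc _ ≤ ∫ p, (-(1 / 4) * interTarget ψ χ u ut us t p +
          8 * A * interMajorant ρ u ut us t p) :=
          integral_mono ((iD'.sub iXs).sub iYs) ((iT.const_mul _).add (iH.const_mul _))
            fun p => h.interDensityDeriv_sub_flux_le hk t p
      _ = -(1 / 4) * (∫ p, interTarget ψ χ u ut us t p) +
          8 * A * ∫ p, interMajorant ρ u ut us t p := by
        rw [integral_add (iT.const_mul _) (iH.const_mul _), integral_const_mul, integral_const_mul]
      _ ≤ -(1 / 4) * (∫ p, interTarget ψ χ u ut us t p) + 8 * A * (9 * E ^ 2) := by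
        gcongr
        exact h.integral_interMajorant_le hk.radius_pos hE t
      _ = _ := by ring
  have ftc : ∫ t in a..(a + T), M' t = M (a + T) - M a :=
    intervalIntegral.integral_eq_sub_of_hasDerivAt (fun t _ => hderiv t)
      (cM'.intervalIntegrable _ _)
  have hle : ∫ t in a..(a + T), M' t ≤ ∫ t in a..(a + T),
      (-(1 / 4) * (∫ p, interTarget ψ χ u ut us t p) + 72 * A * E ^ 2) :=
    intervalIntegral.integral_mono_on (by linarith) (cM'.intervalIntegrable _ _)
      (Continuous.intervalIntegrable (by fun_prop) _ _) fun t _ => hM'le t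
  rw [ftc, intervalIntegral.integral_add (Continuous.intervalIntegrable (by fun_prop) _ _)
    (by simp), intervalIntegral.integral_const_mul, intervalIntegral.integral_const,
    smul_eq_mul] at hle
  have h1 := abs_le.1 (hMle a)
  have h2 := abs_le.1 (hMle (a + T))
  linarith

end WaveJet

section Solution

variable {u : ℝ → E3 → ℝ}

theorem IsNLW.smooth (h : IsNLW u) : Smooth2 u := by
  have := h.1
  rwa [univ_prod_univ, contDiffOn_univ] at this

theorem IsNLW.waveJet (h : IsNLW u) :
    WaveJet u (tderiv u) (tderiv (tderiv u)) (fun i => sderiv i u) (fun i => sderiv i (tderiv u))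
      (fun i j => sderiv i (sderiv j u)) := by
  have hs := h.smooth
  exact
    { cont := hs.continuous
      cont_t := hs.smooth_tderiv.continuous
      cont_tt := hs.smooth_tderiv.smooth_tderiv.continuous
      cont_s := fun i => (hs.smooth_sderiv i).continuous
      cont_ts := fun i => (hs.smooth_tderiv.smooth_sderiv i).continuous
      cont_ss := fun i j => ((hs.smooth_sderiv j).smooth_sderiv i).continuous
      deriv_t := hs.hasDerivAt
      deriv_tt := hs.smooth_tderiv.hasDerivAt
      deriv_st := fun i t x => by
        rw [← hs.tderiv_sderiv]
        exact (hs.smooth_sderiv i).hasDerivAt t x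
      deriv_s := hs.hasLineDerivAt
      deriv_ts := hs.smooth_tderiv.hasLineDerivAt
      deriv_ss := fun i j => (hs.smooth_sderiv j).hasLineDerivAt i
      symm := hs.sderiv_comm
      pde := fun t x => by
        rw [← hs.lap_eq]
        exact h.2.2 t (mem_univ t) x }

theorem jetEnergy_eq (t : ℝ) (x : E3) :
    jetEnergy u (tderiv u) (fun i => sderiv i u) t x =
      (1 / 2) * (tderiv u t x) ^ 2 + (1 / 2) * ‖gradient (u t) x‖ ^ 2 + (1 / 6) * (u t x) ^ 6 := by
  rw [Smooth2.norm_gradient_sq]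
  rfl

theorem jetUpper_eq (t : ℝ) (x : E3) :
    jetUpper u (tderiv u) (fun i => sderiv i u) t x =
      (1 / 2) * (tderiv u t x) ^ 2 + (1 / 2) * ‖gradient (u t) x‖ ^ 2 + (2 / 3) * (u t x) ^ 6 := by
  rw [Smooth2.norm_gradient_sq]
  rfl

theorem jetLower_eq (t : ℝ) (x : E3) :
    jetLower u (tderiv u) (fun i => sderiv i u) t x =
      (1 / 2) * (|tderiv u t x| - ‖gradient (u t) x‖) ^ 2 + (1 / 6) * (u t x) ^ 6 := by
  rw [← Real.sqrt_sq (norm_nonneg (gradient (u t) x)), Smooth2.norm_gradient_sq]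
  rfl

theorem IsNLW.energyBound (h : IsNLW u) {E ρ : ℝ} (hE : ∀ t, energy u t ≤ E) (hρ : 0 < ρ) :
    EnergyBound u (tderiv u) (fun i => sderiv i u) ρ E := by
  have hS := fun t => (h.2.1 t (mem_univ t)).1
  have hSt := fun t => (h.2.1 t (mem_univ t)).2
  have h6 : ∀ t, Integrable fun x => u t x ^ 6 := fun t => by
    have := (hS t).integrable_pow (n := 6) (by norm_num)
    simpa only [Even.pow_abs (by decide : Even 6)] using this
  have hint : ∀ t, Integrable (jetEnergy u (tderiv u) (fun i => sderiv i u) t) := fun t => by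
    have := (((hSt t).integrable_sq.const_mul (1 / 2)).add
      ((hS t).integrable_fderiv_sq.const_mul (1 / 2))).add ((h6 t).const_mul (1 / 6))
    refine this.congr (Filter.Eventually.of_forall fun x => ?_)
    rw [jetEnergy_eq, norm_gradient]
    rfl
  have hle : ∀ t, ∫ x, jetEnergy u (tderiv u) (fun i => sderiv i u) t x ≤ E := fun t => by
    simp only [jetEnergy_eq]
    exact hE t
  refine ⟨hint, fun t => (hS t).integrable_sq, hle, fun t y => ?_⟩
  have h1 : ∫ x, ‖fderiv ℝ (u t) x‖ ^ 2 ≤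
      ∫ x, 2 * jetEnergy u (tderiv u) (fun i => sderiv i u) t x := by
    refine integral_mono (hS t).integrable_fderiv_sq ((hint t).const_mul 2) fun x => ?_
    simp only [jetEnergy_eq, norm_gradient]
    have : 0 ≤ u t x ^ 6 := by positivity
    linarith [sq_nonneg (tderiv u t x)]
  rw [integral_const_mul] at h1
  linarith [(hS t).hardy hρ y, hle t]

end Solution

/-- A smooth bump function equal to `1` on the unit ball and vanishing outside the ball of
radius `2`, with gradient bounded by `B`. -/
structure UnitBump (φ : E3 → ℝ) (B : ℝ) : Prop where
  smooth : ContDiff ℝ 1 φ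
  nonneg : ∀ x, 0 ≤ φ x
  le_one : ∀ x, φ x ≤ 1
  eq_one : ∀ x, ‖x‖ ≤ 1 → φ x = 1
  eq_zero : ∀ x, 2 ≤ ‖x‖ → φ x = 0
  deriv_le : ∀ x, ‖fderiv ℝ φ x‖ ≤ B

/-- The kernel `φ (z / R)`, averaged over `R ∈ [R₀, T]` with respect to `dR / (J R)`. -/
def radialAverage (φ : E3 → ℝ) (R₀ T J : ℝ) (z : E3) : ℝ :=
  ∫ R in R₀..T, (J * max R R₀)⁻¹ * φ ((max R R₀)⁻¹ • z)

namespace UnitBump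

variable {φ : E3 → ℝ} {B : ℝ}

theorem bound_nonneg (h : UnitBump φ B) : 0 ≤ B := (norm_nonneg _).trans (h.deriv_le 0)

theorem fderiv_eq_zero_of_lt (h : UnitBump φ B) {x : E3} (hx : ‖x‖ < 1) : fderiv ℝ φ x = 0 := by
  have : φ =ᶠ[nhds x] fun _ => 1 := by
    filter_upwards [(isOpen_lt continuous_norm continuous_const).mem_nhds hx] with y hy
    exact h.eq_one y (le_of_lt hy)
  rw [this.fderiv_eq, fderiv_const_apply]

theorem fderiv_eq_zero_of_gt (h : UnitBump φ B) {x : E3} (hx : 2 < ‖x‖) : fderiv ℝ φ x = 0 := by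
  have : φ =ᶠ[nhds x] fun _ => 0 := by
    filter_upwards [(isOpen_lt continuous_const continuous_norm).mem_nhds hx] with y hy
    exact h.eq_zero y (le_of_lt hy)
  rw [this.fderiv_eq, fderiv_const_apply]

theorem compact (h : UnitBump φ B) : HasCompactSupport φ :=
  HasCompactSupport.intro (isCompact_closedBall (0 : E3) 2) fun x hx =>
    h.eq_zero x (by simpa using (not_le.1 (by simpa using hx) : 2 < ‖x‖).le)

theorem hasFDerivAt_scale (h : UnitBump φ B) (c : ℝ) (z : E3) :
    HasFDerivAt (fun z => φ (c • z)) (c • fderiv ℝ φ (c • z)) z := by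
  have h1 := (h.smooth.differentiable one_ne_zero (c • z)).hasFDerivAt.comp z
    ((hasFDerivAt_id z).const_smul c)
  convert! h1 using 1
  ext v
  simp

variable {R₀ T J : ℝ}

theorem continuous_average_integrand (h : UnitBump φ B) (hR : 0 < R₀) (hJ : 0 < J) :
    Continuous fun q : E3 × ℝ => (J * max q.2 R₀)⁻¹ * φ ((max q.2 R₀)⁻¹ • q.1) := by
  have hm : ∀ q : E3 × ℝ, max q.2 R₀ ≠ 0 := fun q => (lt_max_of_lt_right hR).ne'
  have hm' : ∀ q : E3 × ℝ, J * max q.2 R₀ ≠ 0 := fun q => mul_ne_zero hJ.ne' (hm q)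
  have c := h.smooth.continuous
  fun_prop (disch := assumption)

theorem continuous_average_deriv (h : UnitBump φ B) (hR : 0 < R₀) (hJ : 0 < J) :
    Continuous fun q : E3 × ℝ =>
      (J * max q.2 R₀)⁻¹ • (max q.2 R₀)⁻¹ • fderiv ℝ φ ((max q.2 R₀)⁻¹ • q.1) := by
  have hm : ∀ q : E3 × ℝ, max q.2 R₀ ≠ 0 := fun q => (lt_max_of_lt_right hR).ne'
  have hm' : ∀ q : E3 × ℝ, J * max q.2 R₀ ≠ 0 := fun q => mul_ne_zero hJ.ne' (hm q)
  have c := h.smooth.continuous_fderiv one_ne_zero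
  fun_prop (disch := assumption)

theorem norm_average_deriv_le (h : UnitBump φ B) (hR : 0 < R₀) (hJ : 0 < J) (z : E3) (R : ℝ) :
    ‖(J * max R R₀)⁻¹ • (max R R₀)⁻¹ • fderiv ℝ φ ((max R R₀)⁻¹ • z)‖ ≤
      (J * max R R₀)⁻¹ * ((max R R₀)⁻¹ * B) := by
  have hm : 0 < max R R₀ := lt_max_of_lt_right hR
  rw [norm_smul, norm_smul, Real.norm_of_nonneg (by positivity), Real.norm_of_nonneg (by positivity)]
  gcongr
  exact h.deriv_le _

theorem hasFDerivAt_average (h : UnitBump φ B) (hR : 0 < R₀) (hJ : 0 < J) (z : E3) :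
    HasFDerivAt (radialAverage φ R₀ T J)
      (∫ R in R₀..T, (J * max R R₀)⁻¹ • (max R R₀)⁻¹ • fderiv ℝ φ ((max R R₀)⁻¹ • z)) z := by
  have c := h.continuous_average_integrand hR hJ
  have c' := h.continuous_average_deriv hR hJ
  have hm : ∀ R, max R R₀ ≠ 0 := fun R => (lt_max_of_lt_right hR).ne'
  have hm' : ∀ R, J * max R R₀ ≠ 0 := fun R => mul_ne_zero hJ.ne' (hm R)
  refine intervalIntegral.hasFDerivAt_integral_of_dominated_of_fderiv_le
    (F := fun z R => (J * max R R₀)⁻¹ * φ ((max R R₀)⁻¹ • z))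
    (bound := fun R => (J * max R R₀)⁻¹ * ((max R R₀)⁻¹ * B)) Filter.univ_mem
    (Filter.Eventually.of_forall fun x =>
      (c.comp (f := fun R => (x, R)) (by fun_prop)).aestronglyMeasurable)
    ((c.comp (f := fun R => (z, R)) (by fun_prop)).intervalIntegrable _ _)
    ((c'.comp (f := fun R => (z, R)) (by fun_prop)).aestronglyMeasurable)
    (Filter.Eventually.of_forall fun R _ x _ => h.norm_average_deriv_le hR hJ x R)
    (Continuous.intervalIntegrable (by fun_prop (disch := assumption)) _ _)
    (Filter.Eventually.of_forall fun R _ x _ => ?_)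
  exact (h.hasFDerivAt_scale (max R R₀)⁻¹ x).const_smul (J * max R R₀)⁻¹

theorem contDiff_average (h : UnitBump φ B) (hR : 0 < R₀) (hJ : 0 < J) :
    ContDiff ℝ 1 (radialAverage φ R₀ T J) := by
  rw [contDiff_one_iff_fderiv]
  refine ⟨fun z => (h.hasFDerivAt_average hR hJ z).differentiableAt, ?_⟩
  rw [funext fun z => (h.hasFDerivAt_average (T := T) hR hJ z).fderiv]
  exact intervalIntegral.continuous_parametric_intervalIntegral_of_continuous'
    (h.continuous_average_deriv hR hJ) _ _

theorem average_nonneg (h : UnitBump φ B) (hR : 0 < R₀) (hJ : 0 < J) (hT : R₀ ≤ T) (z : E3) :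
    0 ≤ radialAverage φ R₀ T J z := by
  refine intervalIntegral.integral_nonneg hT fun R _ => ?_
  have hm : 0 < max R R₀ := lt_max_of_lt_right hR
  have := h.nonneg ((max R R₀)⁻¹ • z)
  positivity

theorem average_eq_zero (h : UnitBump φ B) (hR : 0 < R₀) (hT : R₀ ≤ T) {z : E3}
    (hz : 2 * T ≤ ‖z‖) : radialAverage φ R₀ T J z = 0 := by
  unfold radialAverage
  rw [intervalIntegral.integral_congr (g := fun _ => 0), intervalIntegral.integral_zero]
  intro R hRm
  rw [uIcc_of_le hT] at hRm
  have hm : 0 < max R R₀ := lt_max_of_lt_right hR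
  have hmT : max R R₀ ≤ T := max_le hRm.2 hT
  simp only
  rw [h.eq_zero, mul_zero]
  rw [norm_smul, norm_inv, Real.norm_of_nonneg hm.le, inv_mul_eq_div, le_div_iff₀ hm]
  linarith

theorem average_mul_le (h : UnitBump φ B) (hR : 0 < R₀) (hJ : 0 < J) (hT : R₀ ≤ T) (z : E3) :
    radialAverage φ R₀ T J z * (‖z‖ + R₀) ≤ 3 / J * T := by
  unfold radialAverage
  have c := (h.continuous_average_integrand hR hJ).comp (f := fun R => (z, R)) (by fun_prop)
  rw [← intervalIntegral.integral_mul_const]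
  have : ∀ R, (J * max R R₀)⁻¹ * φ ((max R R₀)⁻¹ • z) * (‖z‖ + R₀) ≤ 3 / J := fun R => by
    have hm : 0 < max R R₀ := lt_max_of_lt_right hR
    rcases le_or_gt 2 ‖(max R R₀)⁻¹ • z‖ with hz | hz
    · rw [h.eq_zero _ hz]
      simp only [mul_zero, zero_mul]
      positivity
    · rw [norm_smul, norm_inv, Real.norm_of_nonneg hm.le, inv_mul_eq_div, div_lt_iff₀ hm] at hz
      calc _ ≤ (J * max R R₀)⁻¹ * 1 * (2 * max R R₀ + max R R₀) := by
            have := h.nonneg ((max R R₀)⁻¹ • z)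
            gcongr
            · exact h.le_one _
            · exact le_max_right _ _
        _ = 3 / J := by field_simp; ring
  calc _ ≤ ∫ R in R₀..T, 3 / J :=
        intervalIntegral.integral_mono_on hT ((c.mul continuous_const).intervalIntegrable _ _)
          (by simp) fun R _ => this R
    _ = 3 / J * (T - R₀) := by
        rw [intervalIntegral.integral_const, smul_eq_mul, mul_comm]
    _ ≤ _ := by gcongr; linarith

theorem average_deriv_mul_le (h : UnitBump φ B) (hR : 0 < R₀) (hJ : 0 < J) (hT : R₀ ≤ T) (z : E3) :
    ‖fderiv ℝ (radialAverage φ R₀ T J) z‖ * (‖z‖ + R₀) ≤ 4 * B / J := by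
  have hB := h.bound_nonneg
  rw [(h.hasFDerivAt_average hR hJ z).fderiv]
  rcases lt_or_ge ‖z‖ R₀ with hz | hz
  · have : ∀ R, fderiv ℝ φ ((max R R₀)⁻¹ • z) = 0 := fun R => by
      have hm : 0 < max R R₀ := lt_max_of_lt_right hR
      apply h.fderiv_eq_zero_of_lt
      rw [norm_smul, norm_inv, Real.norm_of_nonneg hm.le, inv_mul_eq_div, div_lt_one hm]
      exact hz.trans_le (le_max_right _ _)
    simp only [this, smul_zero, intervalIntegral.integral_zero, norm_zero, zero_mul]
    positivity
  · obtain ⟨r, hr⟩ : ∃ r, r = ‖z‖ := ⟨_, rfl⟩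
    rw [← hr] at hz ⊢
    have hr0 : 0 < r := hR.trans_le hz
    have hpt : ∀ R, ‖(J * max R R₀)⁻¹ • (max R R₀)⁻¹ • fderiv ℝ φ ((max R R₀)⁻¹ • z)‖ ≤
        (Icc (r / 2) r).indicator (fun _ => 4 * B / (J * r ^ 2)) (max R R₀) := fun R => by
      have hm : 0 < max R R₀ := lt_max_of_lt_right hR
      have hnorm : ‖(max R R₀)⁻¹ • z‖ = r / max R R₀ := by
        rw [norm_smul, norm_inv, Real.norm_of_nonneg hm.le, inv_mul_eq_div, hr]
      by_cases hmem : max R R₀ ∈ Icc (r / 2) r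
      · rw [indicator_of_mem hmem]
        refine (h.norm_average_deriv_le hR hJ z R).trans ?_
        have h2 : (max R R₀)⁻¹ ≤ (r / 2)⁻¹ := inv_anti₀ (by positivity) hmem.1
        calc (J * max R R₀)⁻¹ * ((max R R₀)⁻¹ * B) = J⁻¹ * ((max R R₀)⁻¹ * (max R R₀)⁻¹) * B := by
              rw [mul_inv]; ring
          _ ≤ J⁻¹ * ((r / 2)⁻¹ * (r / 2)⁻¹) * B := by gcongr
          _ = 4 * B / (J * r ^ 2) := by field_simp; ring
      · rw [indicator_of_notMem hmem]
        have : fderiv ℝ φ ((max R R₀)⁻¹ • z) = 0 := by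
          rw [mem_Icc, not_and_or, not_le, not_le] at hmem
          rcases hmem with hmem | hmem
          · apply h.fderiv_eq_zero_of_gt
            rw [hnorm, lt_div_iff₀ hm]
            linarith
          · apply h.fderiv_eq_zero_of_lt
            rwa [hnorm, div_lt_one hm]
        simp [this]
    have hint : Integrable ((Icc (r / 2) r).indicator fun _ : ℝ => 4 * B / (J * r ^ 2)) :=
      (integrable_indicator_iff measurableSet_Icc).2 (by simp)
    have hle : ‖∫ R in R₀..T, (J * max R R₀)⁻¹ • (max R R₀)⁻¹ • fderiv ℝ φ ((max R R₀)⁻¹ • z)‖ ≤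
        2 * B / (J * r) := by
      calc _ ≤ ∫ R in R₀..T, (Icc (r / 2) r).indicator (fun _ : ℝ => 4 * B / (J * r ^ 2)) R := by
            refine intervalIntegral.norm_integral_le_of_norm_le hT
              (Filter.Eventually.of_forall fun R hRm => ?_) hint.intervalIntegrable
            have := hpt R
            rwa [max_eq_left hRm.1.le] at this ⊢
        _ ≤ ∫ R, (Icc (r / 2) r).indicator (fun _ : ℝ => 4 * B / (J * r ^ 2)) R := by
            rw [intervalIntegral.integral_of_le hT]
            exact setIntegral_le_integral hint (Filter.Eventually.of_forall fun R =>
              indicator_nonneg (fun _ _ => by positivity) R)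
        _ = 2 * B / (J * r) := by
            rw [integral_indicator_const _ measurableSet_Icc, Real.volume_real_Icc_of_le (by linarith),
              smul_eq_mul]
            field_simp
            ring
    calc _ ≤ 2 * B / (J * r) * (r + r) := by gcongr
      _ = 4 * B / J := by field_simp; ring

theorem interKernel (h : UnitBump φ B) (hR : 0 < R₀) (hJ : 0 < J) (hT : R₀ ≤ T) {L : ℝ}
    (hL : 0 < L) (hLT : T * B ≤ L) :
    InterKernel (radialAverage φ R₀ T J) (fun y => φ (L⁻¹ • y)) R₀ ((4 * B + 3) / J) T where
  smooth := h.contDiff_average hR hJ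
  smooth_cutoff := h.smooth.comp (by fun_prop)
  compact := HasCompactSupport.intro (isCompact_closedBall (0 : E3) (2 * T)) fun z hz =>
    h.average_eq_zero hR hT (by simpa using (not_le.1 (by simpa using hz) : 2 * T < ‖z‖).le)
  compact_cutoff := h.compact.comp_homeomorph (Homeomorph.smulOfNeZero L⁻¹ (by positivity))
  nonneg := h.average_nonneg hR hJ hT
  cutoff_nonneg := fun y => h.nonneg _
  cutoff_le := fun y => h.le_one _
  radius_pos := hR
  time_pos := hR.trans_le hT
  kernel_le := fun z => (h.average_mul_le hR hJ hT z).trans (by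
    have := h.bound_nonneg
    have := hR.trans_le hT
    gcongr
    linarith)
  deriv_le := fun z => (h.average_deriv_mul_le hR hJ hT z).trans (by
    gcongr
    linarith)
  deriv_cutoff_le := fun y => by
    have := hR.trans_le hT
    rw [(h.hasFDerivAt_scale _ y).fderiv, norm_smul, norm_inv, Real.norm_of_nonneg hL.le]
    calc T * (L⁻¹ * ‖fderiv ℝ φ (L⁻¹ • y)‖) ≤ T * (L⁻¹ * B) := by
          gcongr
          exact h.deriv_le _
      _ = T * B / L := by ring
      _ ≤ 1 := (div_le_one hL).2 hLT

end UnitBump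

section Average

variable {φ F G : E3 → ℝ} {B R₀ T J : ℝ}

theorem UnitBump.integral_average (h : UnitBump φ B) (hR : 0 < R₀) (hJ : 0 < J) (hT : R₀ ≤ T)
    (cF : Continuous F) (cG : Continuous G) (iF : Integrable F) (iG : Integrable G) :
    ∫ p : E3 × E3, radialAverage φ R₀ T J (p.1 - p.2) * (F p.1 * G p.2) =
      (1 / J) * ∫ R in R₀..T, (1 / R) * ∫ y, ∫ x, F x * φ (R⁻¹ • (x - y)) * G y := by
  have cφ := h.smooth.continuous
  have c := h.continuous_average_integrand hR hJ
  have iFG : Integrable fun p : E3 × E3 => F p.1 * G p.2 := iF.mul_prod iG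
  let f : E3 × E3 → ℝ → ℝ := fun p R =>
    (J * max R R₀)⁻¹ * φ ((max R R₀)⁻¹ • (p.1 - p.2)) * (F p.1 * G p.2)
  have cf : Continuous (uncurry f) :=
    (c.comp (f := fun q : (E3 × E3) × ℝ => (q.1.1 - q.1.2, q.2)) (by fun_prop)).mul
      (by fun_prop)
  have hint : Integrable (uncurry f) (volume.prod (volume.restrict (Ioc R₀ T))) := by
    have hdom : Integrable (fun q : (E3 × E3) × ℝ => ‖F q.1.1 * G q.1.2‖ * (J * R₀)⁻¹)
        (volume.prod (volume.restrict (Ioc R₀ T))) :=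
      iFG.norm.mul_prod (integrable_const _)
    refine hdom.mono' cf.aestronglyMeasurable (Filter.Eventually.of_forall fun q => ?_)
    have hm : 0 < max q.2 R₀ := lt_max_of_lt_right hR
    have h0 := h.nonneg ((max q.2 R₀)⁻¹ • (q.1.1 - q.1.2))
    simp only [uncurry, f]
    rw [norm_mul, Real.norm_of_nonneg (by positivity), mul_comm]
    gcongr
    calc _ ≤ (J * R₀)⁻¹ * 1 := by
          gcongr
          · exact le_max_right _ _
          · exact h.le_one _
      _ = _ := mul_one _
  calc ∫ p : E3 × E3, radialAverage φ R₀ T J (p.1 - p.2) * (F p.1 * G p.2)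
      = ∫ p, ∫ R in Ioc R₀ T, f p R := by
        refine integral_congr_ae (Filter.Eventually.of_forall fun p => ?_)
        simp only [radialAverage, f]
        rw [intervalIntegral.integral_of_le hT, integral_mul_const]
    _ = ∫ R in Ioc R₀ T, ∫ p, f p R := integral_integral_swap hint
    _ = ∫ R in Ioc R₀ T, (1 / J) * ((1 / R) * ∫ y, ∫ x, F x * φ (R⁻¹ • (x - y)) * G y) := by
        refine setIntegral_congr_fun measurableSet_Ioc fun R hRm => ?_
        have hi : Integrable (fun p : E3 × E3 => F p.1 * φ (R⁻¹ • (p.1 - p.2)) * G p.2)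
            ((volume : Measure E3).prod volume) := by
          refine iFG.norm.mono' (Continuous.aestronglyMeasurable (by fun_prop))
            (Filter.Eventually.of_forall fun p => ?_)
          rw [mul_right_comm, norm_mul, Real.norm_of_nonneg (h.nonneg _)]
          exact mul_le_of_le_one_right (norm_nonneg _) (h.le_one _)
        rw [← integral_prod_symm _ hi, ← mul_assoc, ← integral_const_mul, Measure.volume_eq_prod]
        refine integral_congr_ae (Filter.Eventually.of_forall fun p => ?_)
        simp only [f]
        rw [max_eq_left hRm.1.le, mul_inv]
        ring
    _ = _ := by rw [integral_const_mul, intervalIntegral.integral_of_le hT]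

theorem UnitBump.average_le (h : UnitBump φ B) (hR : 0 < R₀) (hJ : 0 < J) (hT : R₀ ≤ T) (z : E3) :
    radialAverage φ R₀ T J z ≤ 3 / J * T / R₀ := by
  rw [le_div_iff₀ hR]
  refine le_trans ?_ (h.average_mul_le hR hJ hT z)
  gcongr
  · exact h.average_nonneg hR hJ hT z
  · linarith [norm_nonneg z]

theorem UnitBump.tendsto_cutoff (h : UnitBump φ B) {L : ℕ → ℝ} (hL : ∀ n : ℕ, n < L n) (y : E3) :
    Filter.Tendsto (fun n => φ ((L n)⁻¹ • y)) Filter.atTop (nhds 1) := by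
  refine tendsto_const_nhds.congr' ?_
  obtain ⟨N, hN⟩ := exists_nat_ge ‖y‖
  filter_upwards [Filter.eventually_ge_atTop N] with n hn
  have hyL : ‖y‖ < L n := (hN.trans (by exact_mod_cast hn)).trans_lt (hL n)
  have hL0 : 0 < L n := (norm_nonneg y).trans_lt hyL
  rw [h.eq_one]
  rw [norm_smul, norm_inv, Real.norm_of_nonneg hL0.le, inv_mul_eq_div, div_le_one hL0]
  exact hyL.le

end Average

namespace WaveJet

variable {u ut utt : ℝ → E3 → ℝ} {us uts : Fin 3 → ℝ → E3 → ℝ}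
  {uss : Fin 3 → Fin 3 → ℝ → E3 → ℝ} {φ : E3 → ℝ} {B R₀ T J E ρ : ℝ}

theorem integrable_lower (h : WaveJet u ut utt us uts uss) (hE : EnergyBound u ut us ρ E) (t : ℝ) :
    Integrable (jetLower u ut us t) :=
  (hE.integrable t).mono' (h.continuous_lower.comp
    (f := fun x => (t, x)) (by fun_prop)).aestronglyMeasurable
    (Filter.Eventually.of_forall fun x => by
      rw [Real.norm_of_nonneg (jetLower_nonneg _ _ _ _ _)]
      exact jetLower_le _ _ _ _ _)

theorem integrable_upper (h : WaveJet u ut utt us uts uss) (hE : EnergyBound u ut us ρ E) (t : ℝ) :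
    Integrable (jetUpper u ut us t) :=
  ((hE.integrable t).const_mul 4).mono' (h.continuous_upper.comp
    (f := fun x => (t, x)) (by fun_prop)).aestronglyMeasurable
    (Filter.Eventually.of_forall fun x => by
      rw [Real.norm_of_nonneg (jetUpper_nonneg _ _ _ _ _)]
      exact jetUpper_le _ _ _ _ _)

theorem integral_lower_mul_upper_le (h : WaveJet u ut utt us uts uss)
    (hE : EnergyBound u ut us ρ E) (t : ℝ) :
    ∫ p : E3 × E3, jetLower u ut us t p.1 * jetUpper u ut us t p.2 ≤ 4 * E ^ 2 := by
  have h1 : ∫ x, jetLower u ut us t x ≤ E :=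
    (integral_mono (h.integrable_lower hE t) (hE.integrable t) fun x =>
      jetLower_le _ _ _ _ _).trans (hE.energy_le t)
  have h2 : ∫ x, jetUpper u ut us t x ≤ 4 * E := by
    refine (integral_mono (h.integrable_upper hE t) ((hE.integrable t).const_mul 4) fun x =>
      jetUpper_le _ _ _ _ _).trans ?_
    rw [integral_const_mul]
    linarith [hE.energy_le t]
  have h3 : 0 ≤ ∫ x, jetLower u ut us t x := integral_nonneg fun x => jetLower_nonneg _ _ _ _ _
  have h4 : 0 ≤ ∫ x, jetUpper u ut us t x := integral_nonneg fun x => jetUpper_nonneg _ _ _ _ _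
  rw [Measure.volume_eq_prod, integral_prod_mul]
  calc _ ≤ E * (4 * E) := by gcongr; exact h3.trans h1
    _ = _ := by ring

/-- The interaction Morawetz estimate for the averaged kernel. -/
theorem interaction_morawetz_average (h : WaveJet u ut utt us uts uss) (hφ : UnitBump φ B)
    (hR : 0 < R₀) (hJ : 0 < J) (hT : R₀ ≤ T) (hE : EnergyBound u ut us R₀ E) (a : ℝ) :
    ∫ t in a..(a + T), ∫ p : E3 × E3, radialAverage φ R₀ T J (p.1 - p.2) *
      (jetLower u ut us t p.1 * jetUpper u ut us t p.2) ≤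
    432 * ((4 * B + 3) / J) * T * E ^ 2 := by
  have hB := hφ.bound_nonneg
  have hT0 : 0 < T := hR.trans_le hT
  let L : ℕ → ℝ := fun n => T * B + n + 1
  have hTB : 0 ≤ T * B := by positivity
  have hL0 : ∀ n, 0 < L n := fun n => by positivity
  have hk := fun n => hφ.interKernel hR hJ hT (hL0 n) (by
    have : (0 : ℝ) ≤ n := n.cast_nonneg
    simp only [L]
    linarith)
  let S := 3 / J * T / R₀
  have hS : 0 ≤ S := by positivity
  have iFG : ∀ t, Integrable fun p : E3 × E3 => jetLower u ut us t p.1 * jetUpper u ut us t p.2 :=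
    fun t => (h.integrable_lower hE t).mul_prod (h.integrable_upper hE t)
  have cTar := fun n => h.continuous_interTarget (hk n).smooth.continuous
    (hk n).smooth_cutoff.continuous
  have hbound : ∀ n t p, ‖interTarget (radialAverage φ R₀ T J) (fun y => φ ((L n)⁻¹ • y)) u ut us
      t p‖ ≤ S * (jetLower u ut us t p.1 * jetUpper u ut us t p.2) := fun n t p => by
    have h1 := hφ.average_nonneg hR hJ hT (p.1 - p.2)
    have h2 := hφ.nonneg ((L n)⁻¹ • p.2)
    have h3 := jetLower_nonneg u ut us t p.1
    have h4 := jetUpper_nonneg u ut us t p.2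
    simp only [interTarget]
    rw [Real.norm_of_nonneg (by positivity)]
    refine mul_le_mul_of_nonneg_right ?_ (by positivity)
    calc _ ≤ S * 1 := mul_le_mul (hφ.average_le hR hJ hT _) (hφ.le_one _) h2 hS
      _ = S := mul_one S
  have hlim : ∀ t, Filter.Tendsto (fun n => ∫ p, interTarget (radialAverage φ R₀ T J)
      (fun y => φ ((L n)⁻¹ • y)) u ut us t p) Filter.atTop
      (nhds (∫ p : E3 × E3, radialAverage φ R₀ T J (p.1 - p.2) *
        (jetLower u ut us t p.1 * jetUpper u ut us t p.2))) := fun t => by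
    refine tendsto_integral_of_dominated_convergence _
      (fun n => ((cTar n).comp (f := fun p => (t, p)) (by fun_prop)).aestronglyMeasurable)
      ((iFG t).const_mul S) (fun n => Filter.Eventually.of_forall (hbound n t))
      (Filter.Eventually.of_forall fun p => ?_)
    have := hφ.tendsto_cutoff (L := L) (fun n => by simp only [L]; linarith) p.2
    simpa [interTarget] using (this.const_mul (radialAverage φ R₀ T J (p.1 - p.2))).mul_const
      (jetLower u ut us t p.1 * jetUpper u ut us t p.2)
  have hlim' := intervalIntegral.tendsto_integral_filter_of_dominated_convergence
    (μ := volume) (a := a) (b := a + T) (fun _ => S * (4 * E ^ 2))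
    (Filter.Eventually.of_forall fun n =>
      (h.continuous_integral_interTarget (hk n)).aestronglyMeasurable)
    (Filter.Eventually.of_forall fun n => Filter.Eventually.of_forall fun t _ => by
      refine (norm_integral_le_of_norm_le ((iFG t).const_mul S)
        (Filter.Eventually.of_forall (hbound n t))).trans ?_
      rw [integral_const_mul]
      exact mul_le_mul_of_nonneg_left (h.integral_lower_mul_upper_le hE t) hS)
    (by simp) (Filter.Eventually.of_forall fun t _ => hlim t)
  exact le_of_tendsto' hlim' fun n => h.interaction_morawetz (hk n) hE a

end WaveJet

/-- the interaction Morawetz estimate, averaged over radii `R ∈ [R₀, e^J R₀]`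
and over a time interval of length `𝒯 = e^J R₀`. -/
theorem stmt13 (φ : E3 → ℝ) (hsm : ContDiff ℝ (⊤ : ℕ∞) φ) (hpos : ∀ x, 0 ≤ φ x)
    (hrad : ∀ x y : E3, ‖x‖ = ‖y‖ → φ x = φ y)
    (hmono : ∀ x y : E3, ‖x‖ ≤ ‖y‖ → φ y ≤ φ x)
    (h1 : ∀ x : E3, ‖x‖ ≤ 1 → φ x = 1) (h0 : ∀ x : E3, 2 ≤ ‖x‖ → φ x = 0) :
    ∃ C : ℝ, 0 < C ∧ ∀ (E : ℝ) (u : ℝ → E3 → ℝ), IsNLW u → (∀ t : ℝ, energy u t ≤ E) →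
      ∀ (R₀ J a : ℝ), 0 < R₀ → 1 ≤ J →
      (∫ t in a..(a + Real.exp J * R₀), (1/J) *
        ∫ R in R₀..(Real.exp J * R₀), (1/R) *
          ∫ y : E3, ∫ x : E3,
            ((1/2) * (|tderiv u t x| - ‖gradient (u t) x‖) ^ 2 + (1/6) * (u t x) ^ 6) *
              φ (R⁻¹ • (x - y)) *
              ((1/2) * (tderiv u t y) ^ 2 + (1/2) * ‖gradient (u t) y‖ ^ 2 +
                (2/3) * (u t y) ^ 6))
        ≤ C * (Real.exp J * R₀) * E ^ 2 / J := by
  have hcs : HasCompactSupport φ :=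
    HasCompactSupport.intro (isCompact_closedBall (0 : E3) 2) fun x hx =>
      h0 x (by simpa using (not_le.1 (by simpa using hx) : 2 < ‖x‖).le)
  obtain ⟨B, hB⟩ := (hsm.continuous_fderiv (by simp)).bounded_above_of_compact_support
    (hcs.fderiv (𝕜 := ℝ))
  have hφ : UnitBump φ B :=
    { smooth := hsm.of_le (by exact_mod_cast le_top)
      nonneg := hpos
      le_one := fun x => (hmono 0 x (by simp)).trans_eq (h1 0 (by simp))
      eq_one := h1
      eq_zero := h0
      deriv_le := hB }
  have hB0 := hφ.bound_nonneg
  refine ⟨432 * (4 * B + 3), by positivity, fun E u hu hE R₀ J a hR hJ => ?_⟩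
  have hJ0 : 0 < J := by linarith
  have hT : R₀ ≤ Real.exp J * R₀ :=
    le_mul_of_one_le_left hR.le (Real.one_le_exp hJ0.le)
  have hw := hu.waveJet
  have hb := hu.energyBound hE hR
  have key := hw.interaction_morawetz_average hφ hR hJ0 hT hb a
  have heq := fun t => hφ.integral_average (F := jetLower u (tderiv u) (fun i => sderiv i u) t)
    (G := jetUpper u (tderiv u) (fun i => sderiv i u) t) hR hJ0 hT
    (hw.continuous_lower.comp (f := fun x => (t, x)) (by fun_prop))
    (hw.continuous_upper.comp (f := fun x => (t, x)) (by fun_prop))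
    (hw.integrable_lower hb t) (hw.integrable_upper hb t)
  rw [intervalIntegral.integral_congr fun t _ => heq t] at key
  simp only [jetLower_eq, jetUpper_eq] at key
  refine key.trans_eq ?_
  ring

end
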